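/- arXiv:2201.02929 — 7 statements merged into one kernel-verified Lean document; each statement's English description precedes it below -/
import Mathlib

section
/- Let N : ℝ → Matrix (Fin n) (Fin n) ℝ be differentiable on [0,∞) with N(0) = 0, N(t) symmetric for every t ≥ 0, and satisfying the matrix Riccati differential equation N'(t) = Θ·N(t) + N(t)·Θᵀ + S·Sᵀ − N(t)·Hᵀ·R⁻¹·H·N(t) for all t ≥ 0, where Θ, S are n×n real matrices, H is an m×n real matrix, and R is an m×m positive-definite real matrix. Then for all 0 ≤ s ≤ t the matrix N(t) − N(s) is positive semidefinite; in particular, the map t ↦ trace(N(t)) is monotone nondecreasing on [0,∞). (Paper's Proposition 1: the MMSE tr(N_t) of the Kalman filter is an increasing function of the age.) -/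
open Matrix

/-- Quadratic forms inherit the entrywise derivative of a matrix-valued function. -/
theorem hasDerivWithinAt_quadForm {ι : Type*} [Fintype ι] {X : ℝ → Matrix ι ι ℝ}
    {X' : Matrix ι ι ℝ} {s : Set ℝ} {t : ℝ}
    (h : ∀ i j, HasDerivWithinAt (fun τ => X τ i j) (X' i j) s t) (v : ι → ℝ) :
    HasDerivWithinAt (fun τ => v ⬝ᵥ (X τ *ᵥ v)) (v ⬝ᵥ (X' *ᵥ v)) s t := by
  simp only [dotProduct, mulVec]
  exact HasDerivWithinAt.fun_sum fun i _ => HasDerivWithinAt.const_mul _ <|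
    HasDerivWithinAt.fun_sum fun j _ => (h i j).mul_const _

theorem isCompact_setOf_dotProduct_self_eq_one (ι : Type*) [Fintype ι] :
    IsCompact {v : ι → ℝ | v ⬝ᵥ v = 1} := by
  refine (isCompact_closedBall (0 : ι → ℝ) 1).of_isClosed_subset
    (isClosed_eq (by fun_prop) continuous_const) fun v hv => ?_
  rw [mem_closedBall_zero_iff, pi_norm_le_iff_of_nonneg zero_le_one]
  intro i
  have h : v i * v i ≤ v ⬝ᵥ v :=
    Finset.single_le_sum (f := fun i => v i * v i) (fun j _ => mul_self_nonneg _)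
      (Finset.mem_univ i)
  rw [show v ⬝ᵥ v = 1 from hv] at h
  rw [Real.norm_eq_abs]
  exact abs_le_one_iff_mul_self_le_one.mpr h

theorem continuousOn_quadForm {ι : Type*} [Fintype ι] {X : ℝ → Matrix ι ι ℝ} {s : Set ℝ}
    (hX : ContinuousOn X s) (V : Set (ι → ℝ)) :
    ContinuousOn (fun p : ℝ × (ι → ℝ) => p.2 ⬝ᵥ (X p.1 *ᵥ p.2)) (s ×ˢ V) := by
  have hq : Continuous fun q : Matrix ι ι ℝ × (ι → ℝ) => q.2 ⬝ᵥ (q.1 *ᵥ q.2) := by fun_prop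
  exact hq.comp_continuousOn ((hX.comp continuousOn_fst fun p hp => hp.1).prodMk continuousOn_snd)

/-- A quadratic form that is nonnegative on unit vectors is nonnegative. -/
theorem quadForm_nonneg_of_unit {ι : Type*} [Fintype ι] {M : Matrix ι ι ℝ}
    (h : ∀ v : ι → ℝ, v ⬝ᵥ v = 1 → 0 ≤ v ⬝ᵥ (M *ᵥ v)) (v : ι → ℝ) :
    0 ≤ v ⬝ᵥ (M *ᵥ v) := by
  by_cases hv : v = 0
  · simp [hv]
  have hpos : 0 < v ⬝ᵥ v := (Matrix.dotProduct_self_star_pos_iff (v := v)).mpr hv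
  have hr : √(v ⬝ᵥ v) * √(v ⬝ᵥ v) = v ⬝ᵥ v := Real.mul_self_sqrt hpos.le
  have hr0 : 0 < √(v ⬝ᵥ v) := Real.sqrt_pos.mpr hpos
  set r := √(v ⬝ᵥ v)
  have := h (r⁻¹ • v) (by
    simp only [smul_dotProduct, dotProduct_smul, smul_eq_mul]
    rw [← hr]; field_simp)
  simp only [mulVec_smul, smul_dotProduct, dotProduct_smul, smul_eq_mul] at this
  exact nonneg_of_mul_nonneg_right (nonneg_of_mul_nonneg_right this (by positivity))
    (by positivity)

/-- A function that is positive before `t₀` and nonpositive at `t₀` has nonpositive derivative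
there. -/
theorem deriv_nonpos_of_pos_left {φ : ℝ → ℝ} {d t₀ : ℝ} (ht₀ : 0 < t₀)
    (hd : HasDerivWithinAt φ d (Set.Ici 0) t₀) (hpos : ∀ t, 0 ≤ t → t < t₀ → 0 < φ t)
    (h0 : φ t₀ ≤ 0) : d ≤ 0 := by
  have hd' : HasDerivWithinAt φ d (Set.Iio t₀) t₀ :=
    (hd.hasDerivAt (Ici_mem_nhds ht₀)).hasDerivWithinAt
  rw [hasDerivWithinAt_iff_tendsto_slope' (by simp)] at hd'
  refine le_of_tendsto hd' ?_
  filter_upwards [self_mem_nhdsWithin, mem_nhdsWithin_of_mem_nhds (Ici_mem_nhds ht₀)] with t ht ht'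
  rw [slope_def_field]
  exact div_nonpos_of_nonneg_of_nonpos (by linarith [hpos t ht' ht]) (by linarith [Set.mem_Iio.mp ht])

/-- Barrier principle: a curve of symmetric matrices that starts positive definite and whose
quadratic form strictly increases along every unit kernel vector stays positive. -/
theorem quadForm_pos_of_barrier {ι : Type*} [Fintype ι] {Y : ℝ → Matrix ι ι ℝ} {T : ℝ}
    (hcont : ContinuousOn Y (Set.Icc 0 T))
    (hsymm : ∀ t ∈ Set.Icc 0 T, (Y t).IsSymm)
    (h0 : ∀ v : ι → ℝ, v ⬝ᵥ v = 1 → 0 < v ⬝ᵥ (Y 0 *ᵥ v))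
    (hder : ∀ t ∈ Set.Icc 0 T, ∀ v : ι → ℝ, v ⬝ᵥ v = 1 → Y t *ᵥ v = 0 →
      ∃ d > 0, HasDerivWithinAt (fun τ => v ⬝ᵥ (Y τ *ᵥ v)) d (Set.Ici 0) t)
    {t : ℝ} (ht : t ∈ Set.Icc 0 T) {v : ι → ℝ} (hv : v ⬝ᵥ v = 1) :
    0 < v ⬝ᵥ (Y t *ᵥ v) := by
  by_contra! hneg
  have hc := continuousOn_quadForm hcont {v : ι → ℝ | v ⬝ᵥ v = 1}
  have hK : IsCompact (Set.Icc 0 T ×ˢ {v : ι → ℝ | v ⬝ᵥ v = 1}) :=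
    isCompact_Icc.prod (isCompact_setOf_dotProduct_self_eq_one ι)
  have hbad := hK.of_isClosed_subset
    (hc.preimage_isClosed_of_isClosed hK.isClosed (isClosed_Iic (a := (0 : ℝ))))
    Set.inter_subset_left
  obtain ⟨⟨t₀, w⟩, ⟨⟨ht₀, hw⟩, hle⟩, hmin⟩ :=
    hbad.exists_isMinOn ⟨(t, v), ⟨ht, hv⟩, hneg⟩ continuous_fst.continuousOn
  simp only [Set.mem_ofPred_eq, Set.mem_preimage, Set.mem_Iic] at ht₀ hw hle
  have hbefore : ∀ τ, 0 ≤ τ → τ < t₀ → ∀ u : ι → ℝ, u ⬝ᵥ u = 1 → 0 < u ⬝ᵥ (Y τ *ᵥ u) := by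
    intro τ hτ hlt u hu
    by_contra! hn
    exact absurd (hmin (a := (τ, u)) ⟨⟨⟨hτ, hlt.le.trans ht₀.2⟩, hu⟩, hn⟩) (not_le.mpr hlt)
  have hpos : 0 < t₀ := ht₀.1.lt_of_ne fun h => by
    subst h; exact absurd hle (not_le.mpr (h0 w hw))
  have hpsd : (Y t₀).PosSemidef := by
    refine PosSemidef.of_dotProduct_mulVec_nonneg (hsymm t₀ ht₀) (quadForm_nonneg_of_unit
      fun u hu => ?_)
    have hcu : ContinuousOn (fun τ => u ⬝ᵥ (Y τ *ᵥ u)) (Set.Icc 0 T) :=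
      hc.comp (continuousOn_id.prodMk continuousOn_const) fun τ hτ => ⟨hτ, hu⟩
    have hnb : (nhdsWithin t₀ (Set.Ico 0 t₀)).NeBot := by
      rw [← mem_closure_iff_nhdsWithin_neBot, closure_Ico hpos.ne]
      exact Set.right_mem_Icc.mpr hpos.le
    have hIco : Set.Ico 0 t₀ ⊆ Set.Icc 0 T := fun τ hτ => ⟨hτ.1, hτ.2.le.trans ht₀.2⟩
    refine ge_of_tendsto ((hcu t₀ ht₀).mono hIco) ?_
    filter_upwards [self_mem_nhdsWithin] with τ hτ
    exact (hbefore τ hτ.1 hτ.2 u hu).le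
  have hker : Y t₀ *ᵥ w = 0 :=
    (hpsd.dotProduct_mulVec_zero_iff w).mp (le_antisymm hle (hpsd.dotProduct_mulVec_nonneg w))
  obtain ⟨d, hd, hderiv⟩ := hder t₀ ht₀ w hw hker
  exact absurd (deriv_nonpos_of_pos_left hpos hderiv (fun τ h1 h2 => hbefore τ h1 h2 w hw) hle)
    (not_le.mpr hd)

theorem continuousOn_of_hasDerivWithinAt_entries {ι κ : Type*} {X X' : ℝ → Matrix ι κ ℝ}
    {s : Set ℝ} (h : ∀ t ∈ s, ∀ i j, HasDerivWithinAt (fun τ => X τ i j) (X' t i j) s t) :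
    ContinuousOn X s :=
  continuousOn_pi.mpr fun i => continuousOn_pi.mpr fun j t ht => (h t ht i j).continuousWithinAt

/-- Solutions of the Lyapunov equation `X' = A X + X Aᵀ + Q` with `Q ≥ 0` preserve positive
semidefiniteness. -/
theorem posSemidef_of_lyapunov {ι : Type*} [Fintype ι] {X A Q : ℝ → Matrix ι ι ℝ}
    (hA : ContinuousOn A (Set.Ici 0)) (hQ : ∀ t, 0 ≤ t → (Q t).PosSemidef)
    (hsymm : ∀ t, 0 ≤ t → (X t).IsSymm) (h0 : (X 0).PosSemidef)
    (hode : ∀ t, 0 ≤ t → ∀ i j, HasDerivWithinAt (fun τ => X τ i j)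
      ((A t * X t + X t * (A t)ᵀ + Q t) i j) (Set.Ici 0) t)
    {T : ℝ} (hT : 0 ≤ T) : (X T).PosSemidef := by
  classical
  have hsub : Set.Icc 0 T ⊆ Set.Ici 0 := Set.Icc_subset_Ici_self
  obtain ⟨C, hC⟩ := (isCompact_Icc.prod (isCompact_setOf_dotProduct_self_eq_one ι)).bddAbove_image
    (continuousOn_quadForm (hA.mono hsub) {v : ι → ℝ | v ⬝ᵥ v = 1})
  have hC' : ∀ t ∈ Set.Icc 0 T, ∀ v : ι → ℝ, v ⬝ᵥ v = 1 → v ⬝ᵥ (A t *ᵥ v) ≤ C :=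
    fun t ht v hv => hC ⟨(t, v), ⟨ht, hv⟩, rfl⟩
  have hXc : ContinuousOn X (Set.Icc 0 T) :=
    (continuousOn_of_hasDerivWithinAt_entries hode).mono hsub
  set g : ℝ → ℝ := fun t => Real.exp ((2 * C + 1) * t)
  have hg : ∀ t, HasDerivAt g ((2 * C + 1) * g t) t := fun t => by
    have := ((hasDerivAt_id t).const_mul (2 * C + 1)).exp
    simpa [g, mul_comm] using this
  have hgc : Continuous g := by fun_prop
  have hquad : ∀ (ε t : ℝ) (v : ι → ℝ), v ⬝ᵥ v = 1 →
      v ⬝ᵥ ((X t + (ε * g t) • (1 : Matrix ι ι ℝ)) *ᵥ v) = v ⬝ᵥ (X t *ᵥ v) + ε * g t := by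
    intro ε t v hv
    simp [add_mulVec, smul_mulVec, hv]
  refine PosSemidef.of_dotProduct_mulVec_nonneg (hsymm T hT) (quadForm_nonneg_of_unit
    fun v hv => ?_)
  refine le_of_forall_pos_le_add fun δ hδ => ?_
  have hε : 0 < δ / g T := div_pos hδ (Real.exp_pos _)
  have hεT : δ / g T * g T = δ := div_mul_cancel₀ _ (Real.exp_pos _).ne'
  set ε := δ / g T
  rw [← hεT, ← hquad ε T v hv]
  refine (quadForm_pos_of_barrier (Y := fun t => X t + (ε * g t) • (1 : Matrix ι ι ℝ)) (T := T)
    ?_ ?_ ?_ ?_ ⟨hT, le_rfl⟩ hv).le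
  · exact hXc.add (by fun_prop)
  · exact fun t ht => (hsymm t ht.1).add (isSymm_one.smul _)
  · intro u hu
    rw [hquad ε 0 u hu]
    exact add_pos_of_nonneg_of_pos (h0.dotProduct_mulVec_nonneg u) (mul_pos hε (Real.exp_pos _))
  · intro t ht u hu hker
    have hXu : X t *ᵥ u = -(ε * g t) • u := by
      rw [add_mulVec, smul_mulVec, one_mulVec] at hker
      rw [neg_smul]; exact eq_neg_of_add_eq_zero_left hker
    have hval : u ⬝ᵥ ((A t * X t + X t * (A t)ᵀ + Q t) *ᵥ u) =
        -(2 * (ε * g t) * (u ⬝ᵥ (A t *ᵥ u))) + u ⬝ᵥ (Q t *ᵥ u) := by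
      have h1 : u ⬝ᵥ ((A t * X t) *ᵥ u) = -(ε * g t) * (u ⬝ᵥ (A t *ᵥ u)) := by
        rw [← mulVec_mulVec, hXu, mulVec_smul, dotProduct_smul, smul_eq_mul]
      have h2 : u ⬝ᵥ ((X t * (A t)ᵀ) *ᵥ u) = u ⬝ᵥ ((A t * X t) *ᵥ u) := by
        have : X t * (A t)ᵀ = (A t * X t)ᵀ := by rw [transpose_mul, (hsymm t ht.1).eq]
        rw [this, mulVec_transpose, dotProduct_comm, ← dotProduct_mulVec]
      rw [add_mulVec, add_mulVec, dotProduct_add, dotProduct_add, h2, h1]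
      ring
    refine ⟨_, ?_, ((hasDerivWithinAt_quadForm (hode t ht.1) u).add
      ((hg t).hasDerivWithinAt.const_mul ε)).congr_of_mem (fun τ _ => hquad ε τ u hu) ht.1⟩
    rw [hval]
    have hQu : 0 ≤ u ⬝ᵥ (Q t *ᵥ u) := (hQ t ht.1).dotProduct_mulVec_nonneg u
    have hεg : 0 < ε * g t := mul_pos hε (Real.exp_pos _)
    nlinarith [mul_nonneg hεg.le (sub_nonneg.mpr (hC' t ht u hu))]



/-- Paper's Proposition 1: if `N` solves the matrix Riccati ODE
`N' = Θ N + N Θᵀ + S Sᵀ − N Hᵀ R⁻¹ H N` on `[0,∞)` with `N 0 = 0`, `N t` symmetric,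
and `R` positive definite, then `N t − N s` is positive semidefinite for `0 ≤ s ≤ t`;
in particular `t ↦ trace (N t)` is nondecreasing on `[0,∞)`. -/
theorem stmt0 {n m : ℕ}
    (Θ S : Matrix (Fin n) (Fin n) ℝ) (H : Matrix (Fin m) (Fin n) ℝ)
    (R : Matrix (Fin m) (Fin m) ℝ) (hR : R.PosDef)
    (N : ℝ → Matrix (Fin n) (Fin n) ℝ)
    (hN0 : N 0 = 0)
    (hsymm : ∀ t : ℝ, 0 ≤ t → (N t).IsSymm)
    (hode : ∀ t : ℝ, 0 ≤ t → ∀ i j, HasDerivWithinAt (fun τ => N τ i j)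
      ((Θ * N t + N t * Θᵀ + S * Sᵀ - N t * Hᵀ * R⁻¹ * H * N t) i j) (Set.Ici 0) t) :
    (∀ s t : ℝ, 0 ≤ s → s ≤ t → (N t - N s).PosSemidef) ∧
      MonotoneOn (fun t => (N t).trace) (Set.Ici 0) := by
  set G : Matrix (Fin n) (Fin n) ℝ := Hᵀ * R⁻¹ * H with hG
  have hGsymm : Gᵀ = G := by
    have hRinv : R⁻¹ᵀ = R⁻¹ := hR.isHermitian.inv
    simp only [hG, transpose_mul, transpose_transpose, hRinv, Matrix.mul_assoc]
  have hcubic : ∀ t, N t * Hᵀ * R⁻¹ * H * N t = N t * G * N t := fun t => by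
    simp only [hG, Matrix.mul_assoc]
  have hNc : ContinuousOn N (Set.Ici 0) := continuousOn_of_hasDerivWithinAt_entries hode
  have hNpsd : ∀ t, 0 ≤ t → (N t).PosSemidef := fun t ht => by
    refine posSemidef_of_lyapunov (A := fun t => Θ - (1 / 2 : ℝ) • (N t * G))
      (Q := fun _ => S * Sᵀ) (by fun_prop) (fun _ _ => posSemidef_self_mul_conjTranspose S)
      hsymm (hN0 ▸ PosSemidef.zero) (fun τ hτ i j => ?_) ht
    refine (hode τ hτ i j).congr_deriv (congrArg (fun M : Matrix _ _ ℝ => M i j) ?_)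
    rw [hcubic, transpose_sub, transpose_smul, transpose_mul, hGsymm, (hsymm τ hτ).eq]
    simp only [sub_mul, mul_sub, smul_mul_assoc, mul_smul_comm, Matrix.mul_assoc]
    module
  have hmono : ∀ s t : ℝ, 0 ≤ s → s ≤ t → (N t - N s).PosSemidef := by
    intro s t hs hst
    set h := t - s with hh
    have hh0 : 0 ≤ h := sub_nonneg.mpr hst
    have hshift : Set.MapsTo (fun τ : ℝ => τ + h) (Set.Ici 0) (Set.Ici 0) :=
      fun τ hτ => add_nonneg hτ hh0
    have hNhc : ContinuousOn (fun τ => N (τ + h)) (Set.Ici 0) :=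
      hNc.comp (by fun_prop) hshift
    have key : (N (s + h) - N s).PosSemidef := by
      refine posSemidef_of_lyapunov (X := fun τ => N (τ + h) - N τ)
        (A := fun τ => Θ - (1 / 2 : ℝ) • ((N (τ + h) + N τ) * G))
        (Q := fun _ => 0) (by fun_prop) (fun _ _ => PosSemidef.zero)
        (fun τ hτ => (hsymm _ (hshift hτ)).sub (hsymm τ hτ))
        (by simpa [hN0] using hNpsd h hh0) (fun τ hτ i j => ?_) hs
      have h1 := (hode (τ + h) (hshift hτ) i j).scomp τ
        ((hasDerivAt_id τ).add_const h).hasDerivWithinAt hshift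
      rw [one_smul] at h1
      refine (h1.sub (hode τ hτ i j)).congr_deriv ?_
      rw [← Matrix.sub_apply]
      refine congrArg (fun M : Matrix _ _ ℝ => M i j) ?_
      rw [hcubic, hcubic, transpose_sub, transpose_smul, transpose_mul, transpose_add, hGsymm,
        (hsymm τ hτ).eq, (hsymm _ (hshift hτ)).eq]
      simp only [sub_mul, mul_sub, add_mul, mul_add, smul_mul_assoc, mul_smul_comm,
        Matrix.mul_assoc]
      module
    rwa [hh, add_sub_cancel] at key
  refine ⟨hmono, fun s hs t _ hst => ?_⟩
  have := (hmono s t hs hst).trace_nonneg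
  rw [trace_sub] at this
  exact sub_nonneg.mp this
end

section
/- Let θ > 0, r > 0, σ ≠ 0, h ≠ 0 be real numbers, and define n̄ = (−θr + √((θr)² + σ²rh²))/h², l = h²/(2√((θr)² + σ²rh²)), and n(Δ) = n̄ − 1/( l + (1/n̄ − l)·exp(2√(θ² + σ²h²/r)·Δ) ). Then 1/n̄ − l > 0, the function n is strictly increasing on [0,∞), and it is bounded: 0 ≤ n(Δ) < n̄ for all Δ ≥ 0. (Paper's Proposition 2: the MMSE is a bounded and increasing function of the age.) -/
/-- Paper's Proposition 2 (monotonicity and boundedness): for the closed-form MMSE `n(Δ)`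
one has `1/n̄ − l > 0`, `n` is strictly increasing on `[0,∞)`, and `0 ≤ n(Δ) < n̄` there. -/
theorem stmt2 (θ r σ h : ℝ) (hθ : 0 < θ) (hr : 0 < r) (hσ : σ ≠ 0) (hh : h ≠ 0)
    (nbar l : ℝ) (n : ℝ → ℝ)
    (hnbar : nbar = (-(θ * r) + Real.sqrt ((θ * r) ^ 2 + σ ^ 2 * r * h ^ 2)) / h ^ 2)
    (hl : l = h ^ 2 / (2 * Real.sqrt ((θ * r) ^ 2 + σ ^ 2 * r * h ^ 2)))
    (hn : ∀ Δ : ℝ, n Δ = nbar -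
      1 / (l + (1 / nbar - l) * Real.exp (2 * Real.sqrt (θ ^ 2 + σ ^ 2 * h ^ 2 / r) * Δ))) :
    0 < 1 / nbar - l ∧
      StrictMonoOn n (Set.Ici 0) ∧
      ∀ Δ : ℝ, 0 ≤ Δ → 0 ≤ n Δ ∧ n Δ < nbar := by
  have ha : 0 < θ * r := mul_pos hθ hr
  have hh2 : 0 < h ^ 2 := by positivity
  have has : θ * r < Real.sqrt ((θ * r) ^ 2 + σ ^ 2 * r * h ^ 2) :=
    Real.lt_sqrt_of_sq_lt (lt_add_of_pos_right _ (by positivity))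
  have hk : 0 < 2 * Real.sqrt (θ ^ 2 + σ ^ 2 * h ^ 2 / r) := by positivity
  generalize Real.sqrt ((θ * r) ^ 2 + σ ^ 2 * r * h ^ 2) = s at hnbar hl has
  generalize 2 * Real.sqrt (θ ^ 2 + σ ^ 2 * h ^ 2 / r) = k at hn hk
  have hs : 0 < s := ha.trans has
  have hnbar_pos : 0 < nbar := hnbar ▸ div_pos (by linarith) hh2
  have hl_pos : 0 < l := hl ▸ by positivity
  have hc : 0 < 1 / nbar - l := by
    rw [hnbar, hl, one_div_div, sub_pos]
    exact div_lt_div_of_pos_left hh2 (by linarith) (by linarith)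
  have hmono : StrictMono n := fun x y hxy => by
    rw [hn, hn]
    gcongr
  have hn_zero : n 0 = 0 := by simp [hn]
  refine ⟨hc, hmono.strictMonoOn _, fun Δ hΔ => ⟨hn_zero ▸ hmono.monotone hΔ, ?_⟩⟩
  rw [hn]
  exact sub_lt_self _ (by positivity)
end

section
/- Let p : [0,∞) → ℝ be nondecreasing, and let Y and Y' be nonnegative integrable random variables with E[Y'] > 0 and E[∫_Y^{Y+Y'} |p(t)| dt] < ∞. Then there exists z̄ ≥ 0 such that p(z̄) · E[Y'] ≥ E[ ∫_Y^{Y+Y'} p(t) dt ]. (Feasibility of the waiting-time bound (12) in the paper's Assumption 1(a), proved in Appendix D.) -/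
open MeasureTheory

/-- Feasibility of the waiting-time bound (12) in the paper's Assumption 1(a)
(proved in Appendix D): for a nondecreasing penalty `p` and nonnegative integrable
`Y, Y'` with `E[Y'] > 0`, there exists `z̄ ≥ 0` with
`p(z̄) · E[Y'] ≥ E[∫_Y^{Y+Y'} p(t) dt]`. -/
theorem stmt5 {Ω : Type*} [MeasurableSpace Ω] (μ : Measure Ω) [IsProbabilityMeasure μ]
    (p : ℝ → ℝ) (hp : MonotoneOn p (Set.Ici 0)) (hpm : Measurable p)
    (Y Y' : Ω → ℝ) (hY : Measurable Y) (hY' : Measurable Y')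
    (hYpos : ∀ ω, 0 ≤ Y ω) (hY'pos : ∀ ω, 0 ≤ Y' ω)
    (hYint : Integrable Y μ) (hY'int : Integrable Y' μ)
    (hY'mean : 0 < ∫ ω, Y' ω ∂μ)
    (habs : Integrable (fun ω => ∫ t in Y ω..(Y ω + Y' ω), |p t|) μ) :
    ∃ zbar : ℝ, 0 ≤ zbar ∧
      p zbar * ∫ ω, Y' ω ∂μ ≥ ∫ ω, (∫ t in Y ω..(Y ω + Y' ω), p t) ∂μ := by
  by_contra! hcon
  set I := ∫ ω, (∫ t in Y ω..(Y ω + Y' ω), p t) ∂μ with hI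
  set m := ∫ ω, Y' ω ∂μ with hm
  obtain ⟨c, hc⟩ : ∃ c, c = I / m := ⟨_, rfl⟩
  have hcm : c * m = I := by rw [hc]; field_simp
  have hpc : ∀ z, 0 ≤ z → p z < c := fun z hz => by
    rw [hc, lt_div_iff₀ hY'mean]
    exact hcon z hz
  -- extend `p` from the half-line to a monotone function on the whole line
  let q : ℝ → ℝ := fun t => p (max t 0)
  have hq : Monotone q := fun a b hab =>
    hp (le_max_right a 0) (le_max_right b 0) (max_le_max_right 0 hab)
  have hqc : ∀ t, 0 < c - q t := fun t => sub_pos.2 (hpc _ (le_max_right t 0))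
  have hq0 : ∀ t, p 0 ≤ q t := fun t =>
    hp Set.self_mem_Ici (le_max_right t 0) (le_max_right t 0)
  have hqi : ∀ a b, IntervalIntegrable q volume a b := fun a b => hq.intervalIntegrable
  have hle : ∀ ω, Y ω ≤ Y ω + Y' ω := fun ω => le_add_of_nonneg_right (hY'pos ω)
  have hpq : ∀ ω, ∫ t in Y ω..(Y ω + Y' ω), p t = ∫ t in Y ω..(Y ω + Y' ω), q t := fun ω => by
    refine intervalIntegral.integral_congr fun t ht => ?_
    rw [Set.uIcc_of_le (hle ω)] at ht
    simp only [q, max_eq_left ((hYpos ω).trans ht.1)]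
  simp only [hpq] at hI
  have hmeas : Measurable fun ω => ∫ t in Y ω..(Y ω + Y' ω), q t := by
    have hF : Continuous fun x => ∫ t in (0 : ℝ)..x, q t :=
      intervalIntegral.continuous_primitive hqi 0
    have heq : (fun ω => ∫ t in Y ω..(Y ω + Y' ω), q t) =
        fun ω => (∫ t in (0 : ℝ)..(Y ω + Y' ω), q t) - ∫ t in (0 : ℝ)..(Y ω), q t := by
      ext ω
      rw [intervalIntegral.integral_interval_sub_left (hqi _ _) (hqi _ _)]
    rw [heq]
    exact (hF.measurable.comp (hY.add hY')).sub (hF.measurable.comp hY)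
  have hgap : ∀ ω, ∫ t in Y ω..(Y ω + Y' ω), (c - q t) =
      c * Y' ω - ∫ t in Y ω..(Y ω + Y' ω), q t := fun ω => by
    rw [intervalIntegral.integral_sub intervalIntegrable_const (hqi _ _),
      intervalIntegral.integral_const, add_sub_cancel_left, smul_eq_mul, mul_comm]
  have hnonneg : ∀ ω, 0 ≤ c * Y' ω - ∫ t in Y ω..(Y ω + Y' ω), q t := fun ω => by
    rw [← hgap]
    exact intervalIntegral.integral_nonneg (hle ω) fun t _ => (hqc t).le
  have hlower : ∀ ω, p 0 * Y' ω ≤ ∫ t in Y ω..(Y ω + Y' ω), q t := fun ω => by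
    have h := intervalIntegral.integral_mono_on (hle ω) (intervalIntegrable_const (c := p 0))
      (hqi _ _) fun t _ => hq0 t
    rwa [intervalIntegral.integral_const, add_sub_cancel_left, smul_eq_mul, mul_comm] at h
  have hint : Integrable (fun ω => ∫ t in Y ω..(Y ω + Y' ω), q t) μ :=
    integrable_of_le_of_le hmeas.aestronglyMeasurable (ae_of_all _ hlower)
      (ae_of_all _ fun ω => sub_nonneg.1 (hnonneg ω)) (hY'int.const_mul (p 0))
      (hY'int.const_mul c)
  have hzero : ∫ ω, (c * Y' ω - ∫ t in Y ω..(Y ω + Y' ω), q t) ∂μ = 0 := by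
    rw [integral_sub (hY'int.const_mul c) hint, integral_const_mul, ← hm, ← hI, hcm, sub_self]
  have hae := (integral_eq_zero_iff_of_nonneg hnonneg ((hY'int.const_mul c).sub hint)).1 hzero
  refine hY'mean.ne' (integral_eq_zero_of_ae ?_)
  filter_upwards [hae] with ω hω
  by_contra hne
  have hpos : 0 < Y' ω := lt_of_le_of_ne (hY'pos ω) (Ne.symm hne)
  have h := intervalIntegral.intervalIntegral_pos_of_pos
    (intervalIntegrable_const.sub (hqi (Y ω) (Y ω + Y' ω))) hqc (lt_add_of_pos_right _ hpos)
  rw [hgap] at h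
  exact h.ne' hω
end

section
/- Let p : [0,∞) → ℝ be nondecreasing with p̲ = p(0) and p̄ = lim_{t→∞} p(t) ∈ (−∞,∞]. Let Y, X, Y' be nonnegative integrable random variables with Y' independent of (Y, X), E[X + Y'] > 0, and for every z ≥ 0, E[∫_Y^{Y+X+z+Y'} |p(t)| dt] < ∞ and E[|p(Y + X + z + Y')|] < ∞. For β ∈ [p̲, p̄) ∩ ℝ define the (measurable, a.s. finite) threshold waiting time Z(β)(ω) = inf{ z ≥ 0 : E_{Y'}[ p( Y(ω) + X(ω) + z + Y' ) ] ≥ β }, and set f(β) = E[ ∫_Y^{Y+X+Z(β)+Y'} p(t) dt ] − β · E[ X + Z(β) + Y' ]. Then f is concave and strictly decreasing on [p̲, p̄) ∩ ℝ. (Paper's Lemma 2, part (1).) -/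
open MeasureTheory ProbabilityTheory

/-- The nonnegative levels beyond which all expectations `E[p(s + z + Y')]` are finite, where `ρ` is
the law of `Y'`. -/
def integrableShifts (p : ℝ → ℝ) (ρ : Measure ℝ) : Set ℝ :=
  {s | 0 ≤ s ∧ ∀ z, 0 ≤ z → Integrable (fun y => p (s + z + y)) ρ}

lemma add_mem_integrableShifts {p : ℝ → ℝ} {ρ : Measure ℝ} {s z : ℝ}
    (hs : s ∈ integrableShifts p ρ) (hz : 0 ≤ z) : s + z ∈ integrableShifts p ρ :=
  ⟨add_nonneg hs.1 hz, fun w hw => by simpa [add_assoc] using hs.2 (z + w) (add_nonneg hz hw)⟩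

lemma integrable_of_mem_integrableShifts {p : ℝ → ℝ} {ρ : Measure ℝ} {s : ℝ}
    (hs : s ∈ integrableShifts p ρ) : Integrable (fun y => p (s + y)) ρ := by
  simpa using hs.2 0 le_rfl

lemma monotoneOn_integral_shift {p : ℝ → ℝ} (hp : Monotone p) (ρ : Measure ℝ) :
    MonotoneOn (fun s => ∫ y, p (s + y) ∂ρ) (integrableShifts p ρ) := fun _ hs _ ht hst =>
  integral_mono (integrable_of_mem_integrableShifts hs) (integrable_of_mem_integrableShifts ht)
    fun _ => hp (by gcongr)

/-- `θ` is a level at which the function `G` crosses `β` on `A`. -/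
structure IsCrossing (G : ℝ → ℝ) (A : Set ℝ) (β θ : ℝ) : Prop where
  le_of_lt : ∀ v ∈ A, θ < v → β ≤ G v
  lt_of_lt : ∀ v ∈ A, v < θ → G v < β

lemma exists_isCrossing {G : ℝ → ℝ} {A : Set ℝ} (hA : ∀ s ∈ A, 0 ≤ s) (hG : MonotoneOn G A)
    {β : ℝ} (hne : ∃ u ∈ A, β ≤ G u) : ∃ θ, IsCrossing G A β θ := by
  have hbdd : BddBelow {u | u ∈ A ∧ β ≤ G u} := ⟨0, fun u hu => hA u hu.1⟩
  refine ⟨sInf {u | u ∈ A ∧ β ≤ G u}, fun v hv hlt => ?_, fun v hv hlt => ?_⟩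
  · obtain ⟨u, ⟨huA, hu⟩, huv⟩ := exists_lt_of_csInf_lt hne hlt
    exact hu.trans (hG huA hv huv.le)
  · by_contra! h
    exact absurd (csInf_le hbdd ⟨hv, h⟩) (not_le.2 hlt)

lemma IsCrossing.sInf_eq {G : ℝ → ℝ} {A : Set ℝ} {β θ s : ℝ} (h : IsCrossing G A β θ)
    (hs : ∀ z, 0 ≤ z → s + z ∈ A) :
    sInf {z : ℝ | 0 ≤ z ∧ β ≤ G (s + z)} = max 0 (θ - s) := by
  have key : ∀ z, max 0 (θ - s) < z → 0 ≤ z ∧ β ≤ G (s + z) := fun z hz => by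
    obtain ⟨h0, h1⟩ := max_lt_iff.1 hz
    exact ⟨h0.le, h.le_of_lt _ (hs z h0.le) (by linarith)⟩
  refine csInf_eq_of_forall_ge_of_forall_gt_exists_lt
    ⟨_, key (max 0 (θ - s) + 1) (by linarith)⟩ ?_ fun w hw => ?_
  · rintro z ⟨hz0, hz⟩
    refine max_le hz0 ?_
    by_contra! hlt
    exact absurd (h.lt_of_lt _ (hs z hz0) (by linarith)) (not_lt.2 hz)
  · exact ⟨(max 0 (θ - s) + w) / 2, key _ (by linarith), by linarith⟩

lemma intervalIntegral_nonneg_of_Ioo {g : ℝ → ℝ} {a b : ℝ} (hab : a ≤ b)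
    (h : ∀ u ∈ Set.Ioo a b, 0 ≤ g u) : 0 ≤ ∫ u in a..b, g u := by
  rw [intervalIntegral.integral_of_le hab, integral_Ioc_eq_integral_Ioo]
  exact setIntegral_nonneg measurableSet_Ioo h

lemma IsCrossing.intervalIntegral_nonneg {G : ℝ → ℝ} {A : Set ℝ} {γ θ s b : ℝ}
    (h : IsCrossing G A γ θ) (hs : ∀ z, 0 ≤ z → s + z ∈ A) (hb : 0 ≤ b) :
    0 ≤ ∫ u in (max 0 (θ - s))..b, (G (s + u) - γ) := by
  rcases le_total (max 0 (θ - s)) b with hab | hab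
  · refine intervalIntegral_nonneg_of_Ioo hab fun u hu => ?_
    obtain ⟨h0, h1⟩ := max_lt_iff.1 hu.1
    exact sub_nonneg.2 (h.le_of_lt _ (hs u h0.le) (by linarith))
  · rw [intervalIntegral.integral_symm, ← intervalIntegral.integral_neg]
    refine intervalIntegral_nonneg_of_Ioo hab fun u hu => ?_
    have hu0 : 0 < u := hb.trans_lt hu.1
    have h1 : u < θ - s := (lt_max_iff.1 hu.2).resolve_left hu0.le.not_gt
    have := h.lt_of_lt _ (hs u hu0.le) (by linarith)
    linarith

lemma integral_intervalIntegral_shift {p : ℝ → ℝ} (hp : Monotone p) {ρ : Measure ℝ}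
    [IsProbabilityMeasure ρ] (hρ : ∀ᵐ y ∂ρ, 0 ≤ y) {s a b γ : ℝ}
    (hs : s ∈ integrableShifts p ρ) (ha : 0 ≤ a) (hb : 0 ≤ b) :
    ∫ y, (∫ u in a..b, (p (s + u + y) - γ)) ∂ρ
      = ∫ u in a..b, ((∫ y, p (s + u + y) ∂ρ) - γ) := by
  rw [← intervalIntegral_integral_swap]
  · refine intervalIntegral.integral_congr fun u hu => ?_
    have hu0 : 0 ≤ u := (le_min ha hb).trans hu.1
    simp [integral_sub (hs.2 u hu0) (integrable_const γ)]
  · have : IsFiniteMeasure (volume.restrict (Set.uIoc a b)) :=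
      ⟨by simp [Set.uIoc]⟩
    have hdom : Integrable (fun y => |p s| + |p (s + max a b + y)|) ρ :=
      (integrable_const _).add (hs.2 _ (le_max_of_le_left ha)).abs
    have hmeas : Measurable fun x : ℝ × ℝ => p (s + x.1 + x.2) :=
      hp.measurable.comp (by fun_prop)
    have hint : Integrable (fun x : ℝ × ℝ => p (s + x.1 + x.2))
        ((volume.restrict (Set.uIoc a b)).prod ρ) := by
      refine (hdom.comp_snd _).mono' hmeas.aestronglyMeasurable ?_
      have h1 : ∀ᵐ x ∂((volume.restrict (Set.uIoc a b)).prod ρ), x.1 ∈ Set.uIoc a b :=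
        Measure.quasiMeasurePreserving_fst.ae (ae_restrict_mem measurableSet_uIoc)
      have h2 : ∀ᵐ x ∂((volume.restrict (Set.uIoc a b)).prod ρ), 0 ≤ x.2 :=
        Measure.quasiMeasurePreserving_snd.ae hρ
      filter_upwards [h1, h2] with x hx1 hx2
      have hx0 : 0 ≤ x.1 := (le_min ha hb).trans hx1.1.le
      have hl : p s ≤ p (s + x.1 + x.2) := hp (by linarith)
      have hr : p (s + x.1 + x.2) ≤ p (s + max a b + x.2) := hp (by linarith [hx1.2])
      rw [Real.norm_eq_abs, abs_le]
      constructor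
      · linarith [neg_abs_le (p s), abs_nonneg (p (s + max a b + x.2))]
      · linarith [le_abs_self (p (s + max a b + x.2)), abs_nonneg (p s)]
    exact hint.sub (integrable_const γ)

/-- Among all waiting rules depending on `s` only, the threshold rule minimises the expected
cumulative excess of the penalty over `γ`. -/
lemma integral_prod_excess_nonneg {p : ℝ → ℝ} (hp : Monotone p) {ν ρ : Measure ℝ}
    [IsProbabilityMeasure ν] [IsProbabilityMeasure ρ] (hρ : ∀ᵐ y ∂ρ, 0 ≤ y)
    (hν : ∀ᵐ s ∂ν, s ∈ integrableShifts p ρ) {γ θ : ℝ}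
    (hθ : IsCrossing (fun s => ∫ y, p (s + y) ∂ρ) (integrableShifts p ρ) γ θ)
    {b : ℝ → ℝ} (hb : ∀ s, 0 ≤ b s) :
    0 ≤ ∫ x, (∫ u in (max 0 (θ - x.1))..b x.1, (p (x.1 + u + x.2) - γ)) ∂(ν.prod ρ) := by
  by_cases hint : Integrable
      (fun x : ℝ × ℝ => ∫ u in (max 0 (θ - x.1))..b x.1, (p (x.1 + u + x.2) - γ)) (ν.prod ρ)
  · rw [integral_prod _ hint]
    refine integral_nonneg_of_ae ?_
    filter_upwards [hν] with s hs
    simp only [Pi.zero_apply]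
    rw [integral_intervalIntegral_shift hp hρ hs (le_max_left _ _) (hb s)]
    exact hθ.intervalIntegral_nonneg (fun z hz => add_mem_integrableShifts hs hz) (hb s)
  · rw [integral_undef hint]

lemma ae_mem_integrableShifts {p : ℝ → ℝ} (hp : Monotone p) {ν ρ : Measure ℝ}
    [IsProbabilityMeasure ν] [IsProbabilityMeasure ρ] (hν : ∀ᵐ s ∂ν, 0 ≤ s)
    (hρ : ∀ᵐ y ∂ρ, 0 ≤ y)
    (hint : ∀ z : ℝ, 0 ≤ z → Integrable (fun x : ℝ × ℝ => p (x.1 + z + x.2)) (ν.prod ρ)) :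
    ∀ᵐ s ∂ν, s ∈ integrableShifts p ρ := by
  have h : ∀ᵐ s ∂ν, ∀ n : ℕ, Integrable (fun y => p (s + n + y)) ρ :=
    ae_all_iff.2 fun n => (hint n n.cast_nonneg).prod_right_ae
  filter_upwards [hν, h] with s hs hn
  refine ⟨hs, fun z hz => ?_⟩
  obtain ⟨n, hzn⟩ := exists_nat_ge z
  refine ((integrable_const |p s|).add (hn n).abs).mono'
    (hp.measurable.comp (by fun_prop)).aestronglyMeasurable ?_
  filter_upwards [hρ] with y hy
  have hl : p s ≤ p (s + z + y) := hp (by linarith)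
  have hr : p (s + z + y) ≤ p (s + n + y) := hp (by linarith)
  simp only [Pi.add_apply]
  rw [Real.norm_eq_abs, abs_le]
  constructor
  · linarith [neg_abs_le (p s), abs_nonneg (p (s + n + y))]
  · linarith [le_abs_self (p (s + n + y)), abs_nonneg (p s)]

/-- A function that is bounded above by an affine function of slope `-c β` touching it at `β`, for
every `β` in a convex set, is concave there, and strictly decreasing if all `c β` are positive. -/
lemma concaveOn_and_strictAntiOn_of_supporting {D : Set ℝ} (hD : Convex ℝ D) {f g c : ℝ → ℝ}
    (hf : ∀ β ∈ D, f β = g β - β * c β) (hc : ∀ β ∈ D, 0 < c β)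
    (h : ∀ β ∈ D, ∀ γ ∈ D, f γ ≤ g β - γ * c β) :
    ConcaveOn ℝ D f ∧ StrictAntiOn f D := by
  refine ⟨⟨hD, fun x hx y hy a b ha hb hab => ?_⟩, fun x hx y hy hxy => ?_⟩
  · have hz := hD hx hy ha hb hab
    have h1 := mul_le_mul_of_nonneg_left (h _ hz x hx) ha
    have h2 := mul_le_mul_of_nonneg_left (h _ hz y hy) hb
    rw [hf _ hz]
    simp only [smul_eq_mul] at *
    have hb' : b = 1 - a := by linarith
    subst hb'
    linarith
  · have h1 := h x hx y hy
    have h2 := mul_lt_mul_of_pos_right hxy (hc x hx)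
    rw [hf x hx]
    linarith

lemma concaveOn_strictAntiOn_of_monotone {Ω : Type*} [MeasurableSpace Ω] (μ : Measure Ω)
    [IsProbabilityMeasure μ] (p : ℝ → ℝ) (hp : Monotone p) (pbar : EReal)
    (hpbar : Filter.Tendsto (fun t : ℝ => ((p t : ℝ) : EReal)) Filter.atTop (nhds pbar))
    (Y X Y' : Ω → ℝ) (hY : Measurable Y) (hX : Measurable X) (hY' : Measurable Y')
    (hYpos : ∀ ω, 0 ≤ Y ω) (hXpos : ∀ ω, 0 ≤ X ω) (hY'pos : ∀ ω, 0 ≤ Y' ω)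
    (hXint : Integrable X μ) (hY'int : Integrable Y' μ)
    (hindep : IndepFun (fun ω => (Y ω, X ω)) Y' μ)
    (hmean : 0 < ∫ ω, (X ω + Y' ω) ∂μ)
    (hint1 : ∀ z : ℝ, 0 ≤ z →
      Integrable (fun ω => ∫ t in Y ω..(Y ω + X ω + z + Y' ω), |p t|) μ)
    (hint2 : ∀ z : ℝ, 0 ≤ z → Integrable (fun ω => p (Y ω + X ω + z + Y' ω)) μ)
    (Z : ℝ → Ω → ℝ)
    (hZ : ∀ β ω, Z β ω = sInf {z : ℝ | 0 ≤ z ∧ β ≤ ∫ ω', p (Y ω + X ω + z + Y' ω') ∂μ})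
    (f : ℝ → ℝ)
    (hf : ∀ β, f β = (∫ ω, (∫ t in Y ω..(Y ω + X ω + Z β ω + Y' ω), p t) ∂μ)
      - β * ∫ ω, (X ω + Z β ω + Y' ω) ∂μ) :
    ConcaveOn ℝ {β : ℝ | p 0 ≤ β ∧ ((β : ℝ) : EReal) < pbar} f ∧
      StrictAntiOn f {β : ℝ | p 0 ≤ β ∧ ((β : ℝ) : EReal) < pbar} := by
  set S : Ω → ℝ := fun ω => Y ω + X ω with hSdef
  have hS : Measurable S := hY.add hX
  have hSpos : ∀ ω, 0 ≤ S ω := fun ω => add_nonneg (hYpos ω) (hXpos ω)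
  set ν := μ.map S with hνdef
  set ρ := μ.map Y' with hρdef
  have : IsProbabilityMeasure ν := Measure.isProbabilityMeasure_map hS.aemeasurable
  have : IsProbabilityMeasure ρ := Measure.isProbabilityMeasure_map hY'.aemeasurable
  have hSY' : IndepFun S Y' μ :=
    hindep.comp (φ := fun x : ℝ × ℝ => x.1 + x.2) (ψ := id) (by fun_prop) measurable_id
  have hprod : μ.map (fun ω => (S ω, Y' ω)) = ν.prod ρ :=
    (indepFun_iff_map_prod_eq_prod_map_map hS.aemeasurable hY'.aemeasurable).1 hSY'
  have hpair : Measurable fun ω => (S ω, Y' ω) := hS.prodMk hY'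
  have hν0 : ∀ᵐ s ∂ν, 0 ≤ s :=
    (ae_map_iff hS.aemeasurable measurableSet_Ici).2 (ae_of_all _ hSpos)
  have hρ0 : ∀ᵐ y ∂ρ, 0 ≤ y :=
    (ae_map_iff hY'.aemeasurable measurableSet_Ici).2 (ae_of_all _ hY'pos)
  have hνA : ∀ᵐ s ∂ν, s ∈ integrableShifts p ρ := by
    refine ae_mem_integrableShifts hp hν0 hρ0 fun z hz => ?_
    rw [← hprod]
    refine (integrable_map_measure (hp.measurable.comp (by fun_prop)).aestronglyMeasurable
      hpair.aemeasurable).2 ?_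
    exact hint2 z hz
  have hSA : ∀ᵐ ω ∂μ, S ω ∈ integrableShifts p ρ := ae_of_ae_map hS.aemeasurable hνA
  have hG : ∀ s, ∫ ω, p (s + Y' ω) ∂μ = ∫ y, p (s + y) ∂ρ := fun s =>
    (integral_map hY'.aemeasurable
      (hp.measurable.comp (measurable_const_add s)).aestronglyMeasurable).symm
  -- the threshold rule in terms of crossing levels
  have hcross : ∀ β : ℝ, (β : EReal) < pbar → ∃ θ,
      IsCrossing (fun s => ∫ y, p (s + y) ∂ρ) (integrableShifts p ρ) β θ := fun β hβ => by
    refine exists_isCrossing (fun s hs => hs.1) (monotoneOn_integral_shift hp ρ) ?_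
    obtain ⟨s, hs⟩ := hνA.exists
    obtain ⟨T, hT, hT0⟩ :=
      ((hpbar.eventually_const_lt hβ).and (Filter.eventually_ge_atTop 0)).exists
    have hsT := add_mem_integrableShifts hs hT0
    refine ⟨s + T, hsT, ?_⟩
    have : ∫ _, β ∂ρ ≤ ∫ y, p (s + T + y) ∂ρ := by
      refine integral_mono_ae (integrable_const β) (integrable_of_mem_integrableShifts hsT) ?_
      filter_upwards [hρ0] with y hy
      exact (EReal.coe_lt_coe_iff.1 hT).le.trans (hp (by linarith [hs.1]))
    simpa using this
  choose! θ hθ using hcross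
  set W : ℝ → Ω → ℝ := fun β ω => max 0 (θ β - S ω) with hWdef
  have hW0 : ∀ β ω, 0 ≤ W β ω := fun β ω => le_max_left _ _
  have hWle : ∀ β ω, W β ω ≤ |θ β| := fun β ω =>
    max_le (abs_nonneg _) (by linarith [le_abs_self (θ β), hSpos ω])
  have hWm : ∀ β, Measurable (W β) := fun β => by fun_prop
  have hWint : ∀ β, Integrable (W β) μ := fun β =>
    (integrable_const |θ β|).mono' (hWm β).aestronglyMeasurable
      (ae_of_all _ fun ω => by rw [Real.norm_eq_abs, abs_of_nonneg (hW0 β ω)]; exact hWle β ω)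
  have hZW : ∀ β : ℝ, (β : EReal) < pbar → Z β =ᵐ[μ] W β := fun β hβ => by
    filter_upwards [hSA] with ω hω
    rw [hZ]
    simp only [hG]
    exact (hθ β hβ).sInf_eq fun z hz => add_mem_integrableShifts hω hz
  have hpi : ∀ a b, IntervalIntegrable p volume a b := fun a b => hp.intervalIntegrable
  -- integrability of the cumulative penalty
  have hIint : ∀ β, Integrable (fun ω => ∫ t in Y ω..(Y ω + X ω + W β ω + Y' ω), p t) μ := by
    intro β
    have hcont := intervalIntegral.continuous_primitive hpi 0
    refine (hint1 |θ β| (abs_nonneg _)).mono' ?_ (ae_of_all _ fun ω => ?_)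
    · have heq : (fun ω => ∫ t in Y ω..(Y ω + X ω + W β ω + Y' ω), p t) = fun ω =>
          (∫ t in (0 : ℝ)..(Y ω + X ω + W β ω + Y' ω), p t) - ∫ t in (0 : ℝ)..Y ω, p t :=
        funext fun ω => (intervalIntegral.integral_interval_sub_left (hpi _ _) (hpi _ _)).symm
      rw [heq]
      refine Measurable.aestronglyMeasurable ?_
      exact (hcont.measurable.comp (((hY.add hX).add (hWm β)).add hY')).sub
        (hcont.measurable.comp hY)
    · have h1 := hXpos ω
      have h2 := hY'pos ω
      have h3 := hW0 β ω
      refine (intervalIntegral.abs_integral_le_integral_abs (by linarith)).trans ?_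
      exact intervalIntegral.integral_mono_interval le_rfl (by linarith)
        (by linarith [hWle β ω]) (ae_of_all _ fun t => abs_nonneg _) (hpi _ _).abs
  have hLint : ∀ β, Integrable (fun ω => X ω + W β ω + Y' ω) μ := fun β =>
    (hXint.add (hWint β)).add hY'int
  set g : ℝ → ℝ := fun β => ∫ ω, (∫ t in Y ω..(Y ω + X ω + W β ω + Y' ω), p t) ∂μ with hg
  set c : ℝ → ℝ := fun β => ∫ ω, (X ω + W β ω + Y' ω) ∂μ with hc
  have hfW : ∀ β : ℝ, (β : EReal) < pbar → f β = g β - β * c β := fun β hβ => by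
    rw [hf, hg, hc]
    congr 1
    · refine integral_congr_ae ?_
      filter_upwards [hZW β hβ] with ω hω
      rw [hω]
    · congr 1
      refine integral_congr_ae ?_
      filter_upwards [hZW β hβ] with ω hω
      rw [hω]
  refine concaveOn_and_strictAntiOn_of_supporting (g := g) (c := c) ?_
    (fun β hβ => hfW β hβ.2) (fun β _ => ?_) fun β hβ γ hγ => ?_
  · refine Set.OrdConnected.convex ⟨fun x hx y hy z hz => ⟨hx.1.trans hz.1, ?_⟩⟩
    exact (EReal.coe_le_coe_iff.2 hz.2).trans_lt hy.2
  · refine hmean.trans_le (integral_mono (hXint.add hY'int) (hLint β) fun ω => ?_)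
    linarith [hW0 β ω]
  · rw [hfW γ hγ.2]
    have hnonneg := integral_prod_excess_nonneg hp hρ0 hνA (hθ γ hγ.2)
      (b := fun s => max 0 (θ β - s)) (fun s => le_max_left _ _)
    have hexc : ∀ s y a b : ℝ, ∫ u in a..b, (p (s + u + y) - γ)
        = (∫ t in (0 : ℝ)..(s + b + y), p t) - (∫ t in (0 : ℝ)..(s + a + y), p t)
          - γ * (b - a) := fun s y a b => by
      have hsh : (fun u => p (s + u + y)) = fun u => p ((s + y) + u) := by
        funext u; congr 1; ring
      have hm : Monotone fun u => p ((s + y) + u) := fun u v huv => hp (by linarith)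
      rw [intervalIntegral.integral_sub (hsh ▸ hm.intervalIntegrable)
        intervalIntegrable_const, hsh, intervalIntegral.integral_comp_add_left (fun u => p u),
        intervalIntegral.integral_interval_sub_left (hpi _ _) (hpi _ _),
        intervalIntegral.integral_const, smul_eq_mul, mul_comm (b - a),
        add_right_comm s a y, add_right_comm s b y]
    have hcont := intervalIntegral.continuous_primitive hpi 0
    rw [← hprod, integral_map hpair.aemeasurable] at hnonneg
    · have hpt : ∀ ω, (∫ u in (max 0 (θ γ - S ω))..(max 0 (θ β - S ω)),
            (p (S ω + u + Y' ω) - γ))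
          = ((∫ t in Y ω..(Y ω + X ω + W β ω + Y' ω), p t)
            - (∫ t in Y ω..(Y ω + X ω + W γ ω + Y' ω), p t))
            - γ * ((X ω + W β ω + Y' ω) - (X ω + W γ ω + Y' ω)) := fun ω => by
        rw [hexc, ← intervalIntegral.integral_interval_sub_left (hpi 0 _) (hpi 0 (Y ω)),
          ← intervalIntegral.integral_interval_sub_left (hpi 0 _) (hpi 0 (Y ω))]
        simp only [hWdef, hSdef]
        ring
      simp only [hpt] at hnonneg
      have hdI : Integrable (fun ω => (∫ t in Y ω..(Y ω + X ω + W β ω + Y' ω), p t)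
          - ∫ t in Y ω..(Y ω + X ω + W γ ω + Y' ω), p t) μ := (hIint β).sub (hIint γ)
      have hdL : Integrable (fun ω => (X ω + W β ω + Y' ω) - (X ω + W γ ω + Y' ω)) μ :=
        (hLint β).sub (hLint γ)
      rw [integral_sub hdI (hdL.const_mul γ),
        integral_sub (hIint β) (hIint γ), integral_const_mul,
        integral_sub (hLint β) (hLint γ)] at hnonneg
      simp only [hg, hc]
      linarith
    · simp only [hexc]
      refine Continuous.aestronglyMeasurable ?_
      exact ((hcont.comp (by fun_prop)).sub (hcont.comp (by fun_prop))).sub (by fun_prop)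

/-- Paper's Lemma 2, part (1): the Dinkelbach-type function
`f(β) = E[∫_Y^{Y+X+Z(β)+Y'} p(t) dt] − β E[X + Z(β) + Y']`, where `Z(β)` is the
threshold waiting time, is concave and strictly decreasing on `[p(0), p̄) ∩ ℝ`. -/
theorem stmt8 {Ω : Type*} [MeasurableSpace Ω] (μ : Measure Ω) [IsProbabilityMeasure μ]
    (p : ℝ → ℝ) (hp : MonotoneOn p (Set.Ici 0)) (hpm : Measurable p)
    (pbar : EReal)
    (hpbar : Filter.Tendsto (fun t : ℝ => ((p t : ℝ) : EReal)) Filter.atTop (nhds pbar))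
    (Y X Y' : Ω → ℝ) (hY : Measurable Y) (hX : Measurable X) (hY' : Measurable Y')
    (hYpos : ∀ ω, 0 ≤ Y ω) (hXpos : ∀ ω, 0 ≤ X ω) (hY'pos : ∀ ω, 0 ≤ Y' ω)
    (hYint : Integrable Y μ) (hXint : Integrable X μ) (hY'int : Integrable Y' μ)
    (hindep : IndepFun (fun ω => (Y ω, X ω)) Y' μ)
    (hmean : 0 < ∫ ω, (X ω + Y' ω) ∂μ)
    (hint1 : ∀ z : ℝ, 0 ≤ z →
      Integrable (fun ω => ∫ t in Y ω..(Y ω + X ω + z + Y' ω), |p t|) μ)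
    (hint2 : ∀ z : ℝ, 0 ≤ z → Integrable (fun ω => p (Y ω + X ω + z + Y' ω)) μ)
    (Z : ℝ → Ω → ℝ)
    (hZ : ∀ β ω, Z β ω = sInf {z : ℝ | 0 ≤ z ∧ β ≤ ∫ ω', p (Y ω + X ω + z + Y' ω') ∂μ})
    (f : ℝ → ℝ)
    (hf : ∀ β, f β = (∫ ω, (∫ t in Y ω..(Y ω + X ω + Z β ω + Y' ω), p t) ∂μ)
      - β * ∫ ω, (X ω + Z β ω + Y' ω) ∂μ) :
    ConcaveOn ℝ {β : ℝ | p 0 ≤ β ∧ ((β : ℝ) : EReal) < pbar} f ∧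
      StrictAntiOn f {β : ℝ | p 0 ≤ β ∧ ((β : ℝ) : EReal) < pbar} := by
  have hmax : ∀ t, 0 ≤ t → p (max t 0) = p t := fun t ht => by rw [max_eq_left ht]
  have hq : Monotone fun t => p (max t 0) := fun a b hab =>
    hp (Set.mem_Ici.2 (le_max_right a 0)) (Set.mem_Ici.2 (le_max_right b 0))
      (max_le_max_right 0 hab)
  have hsum : ∀ z, 0 ≤ z → ∀ ω ω', 0 ≤ Y ω + X ω + z + Y' ω' := fun z hz ω ω' =>
    add_nonneg (add_nonneg (add_nonneg (hYpos ω) (hXpos ω)) hz) (hY'pos ω')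
  have hZ0 : ∀ β ω, 0 ≤ Z β ω := fun β ω => by
    rw [hZ]
    exact Real.sInf_nonneg fun z hz => hz.1
  have hnn : ∀ {z}, 0 ≤ z → ∀ ω, ∀ t ∈ Set.uIcc (Y ω) (Y ω + X ω + z + Y' ω), 0 ≤ t :=
    fun hz ω t ht => (le_min (hYpos ω) (hsum _ hz ω ω)).trans ht.1
  have h0 : p 0 = (fun t => p (max t 0)) 0 := (hmax 0 le_rfl).symm
  rw [h0]
  refine concaveOn_strictAntiOn_of_monotone μ (fun t => p (max t 0)) hq pbar ?_ Y X Y' hY hX hY'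
    hYpos hXpos hY'pos hXint hY'int hindep hmean (fun z hz => ?_) (fun z hz => ?_) Z
    (fun β ω => ?_) f fun β => ?_
  · refine hpbar.congr' ?_
    filter_upwards [Filter.eventually_ge_atTop 0] with t ht
    rw [hmax t ht]
  · refine (hint1 z hz).congr (ae_of_all _ fun ω => ?_)
    refine intervalIntegral.integral_congr fun t ht => ?_
    simp only [hmax t (hnn hz ω t ht)]
  · simpa only [hmax _ (hsum z hz _ _)] using hint2 z hz
  · rw [hZ]
    congr 1
    ext z
    refine and_congr_right fun hz => ?_
    simp only [hmax _ (hsum z hz _ _)]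
  · rw [hf]
    congr 1
    refine integral_congr_ae (ae_of_all _ fun ω => ?_)
    refine intervalIntegral.integral_congr fun t ht => ?_
    simp only [hmax t (hnn (hZ0 β ω) ω t ht)]
end

section
/- Let p : [0,∞) → ℝ be nondecreasing with p̲ = p(0) and p̄ = lim_{t→∞} p(t) ∈ (−∞,∞], and assume p(t) < p̄ for all t ≥ 0. Let Y, X, Y' be nonnegative integrable random variables with Y' independent of (Y, X), E[X + Y'] > 0, and for every z ≥ 0, E[∫_Y^{Y+X+z+Y'} |p(t)| dt] < ∞ and E[|p(Y + X + z + Y')|] < ∞. Define Z(β)(ω) = inf{ z ≥ 0 : E_{Y'}[ p( Y(ω) + X(ω) + z + Y' ) ] ≥ β } and f(β) = E[ ∫_Y^{Y+X+Z(β)+Y'} p(t) dt ] − β · E[ X + Z(β) + Y' ]. Then there exists exactly one β ∈ [p̲, p̄) ∩ ℝ with f(β) = 0. (Paper's Lemma 2, part (2): existence and uniqueness of the root defining the optimal objective value.) -/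
open MeasureTheory ProbabilityTheory

/-- The primitive of a monotone function is continuous. -/
lemma Monotone.continuous_intervalIntegral {q : ℝ → ℝ} (hq : Monotone q) :
    Continuous (fun x => ∫ t in (0 : ℝ)..x, q t) :=
  intervalIntegral.continuous_primitive (fun _ _ => hq.intervalIntegrable) 0

/-- The interval integral of a monotone function is measurable in its endpoints. -/
lemma Monotone.measurable_intervalIntegral {α : Type*} [MeasurableSpace α] {q : ℝ → ℝ}
    (hq : Monotone q) {a b : α → ℝ} (ha : Measurable a) (hb : Measurable b) :
    Measurable (fun ω => ∫ t in a ω..b ω, q t) := by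
  have h : (fun ω => ∫ t in a ω..b ω, q t)
      = fun ω => (∫ t in (0 : ℝ)..b ω, q t) - ∫ t in (0 : ℝ)..a ω, q t := by
    funext ω
    exact (intervalIntegral.integral_interval_sub_left hq.intervalIntegrable
      hq.intervalIntegrable).symm
  rw [h]
  exact (hq.continuous_intervalIntegral.measurable.comp hb).sub
    (hq.continuous_intervalIntegral.measurable.comp ha)

/-- If `q (S + n + V)` is integrable for all `n`, with `S` and `V` independent, then `q (s + V)`
is integrable for every `s ≥ 0`. -/
lemma Monotone.integrable_comp_add {Ω : Type*} [MeasurableSpace Ω] {μ : Measure Ω}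
    [IsProbabilityMeasure μ] {q : ℝ → ℝ} (hq : Monotone q) {S V : Ω → ℝ} (hS : Measurable S)
    (hV : Measurable V) (hVpos : ∀ ω, 0 ≤ V ω) (hSV : IndepFun S V μ)
    (hint : ∀ z : ℝ, 0 ≤ z → Integrable (fun ω => q (S ω + z + V ω)) μ)
    {s : ℝ} (hs : 0 ≤ s) : Integrable (fun ω => q (s + V ω)) μ := by
  have hprod := hSV.map_prod_eq_prod_map_map hS.aemeasurable hV.aemeasurable
  have := Measure.isProbabilityMeasure_map (μ := μ) hS.aemeasurable
  have := Measure.isProbabilityMeasure_map (μ := μ) hV.aemeasurable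
  have hae : ∀ n : ℕ, ∀ᵐ x ∂(μ.map S), Integrable (fun y => q (x + n + y)) (μ.map V) := by
    intro n
    have hmeas : Measurable (fun r : ℝ × ℝ => q (r.1 + n + r.2)) :=
      hq.measurable.comp (by fun_prop)
    have h1 : Integrable (fun r : ℝ × ℝ => q (r.1 + n + r.2)) ((μ.map S).prod (μ.map V)) := by
      rw [← hprod, integrable_map_measure hmeas.aestronglyMeasurable
        (hS.prodMk hV).aemeasurable]
      exact hint n n.cast_nonneg
    exact h1.prod_right_ae
  obtain ⟨x, hx⟩ := (ae_all_iff.2 hae).exists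
  obtain ⟨n, hn⟩ := exists_nat_ge (s - x)
  have hn' : Integrable (fun ω => q (x + n + V ω)) μ := by
    have hmeas : Measurable (fun y => q (x + n + y)) := hq.measurable.comp (by fun_prop)
    exact (integrable_map_measure hmeas.aestronglyMeasurable hV.aemeasurable).1 (hx n)
  refine integrable_of_le_of_le (g₁ := fun _ => q 0)
    (hq.measurable.comp (by fun_prop)).aestronglyMeasurable
    (Filter.Eventually.of_forall fun ω => ?_) (Filter.Eventually.of_forall fun ω => ?_)
    (integrable_const _) hn'
  · exact hq (add_nonneg hs (hVpos ω))
  · exact hq (by linarith)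

/-- Fubini for the integral of a monotone function over a randomly translated interval. -/
lemma Monotone.integral_intervalIntegral_add {Ω : Type*} [MeasurableSpace Ω] {μ : Measure Ω}
    [IsProbabilityMeasure μ] {q : ℝ → ℝ} (hq : Monotone q) {V : Ω → ℝ} (hV : Measurable V)
    {a b : ℝ} (hab : a ≤ b) (ha : Integrable (fun ω => q (a + V ω)) μ)
    (hb : Integrable (fun ω => q (b + V ω)) μ) :
    ∫ ω, (∫ t in (a + V ω)..(b + V ω), q t) ∂μ = ∫ u in a..b, (∫ ω, q (u + V ω) ∂μ) := by
  have hint : Integrable (Function.uncurry fun (u : ℝ) (ω : Ω) => q (u + V ω))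
      ((volume.restrict (Set.uIoc a b)).prod μ) := by
    rw [Set.uIoc_of_le hab]
    have hmem : ∀ᵐ r ∂((volume.restrict (Set.Ioc a b)).prod μ), r.1 ∈ Set.Ioc a b :=
      Measure.quasiMeasurePreserving_fst.ae (ae_restrict_mem measurableSet_Ioc)
    refine integrable_of_le_of_le (g₁ := fun r => q (a + V r.2)) (g₂ := fun r => q (b + V r.2))
      (hq.measurable.comp (by fun_prop)).aestronglyMeasurable ?_ ?_
      (ha.comp_snd _) (hb.comp_snd _)
    · filter_upwards [hmem] with r hr
      exact hq (by linarith [hr.1])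
    · filter_upwards [hmem] with r hr
      exact hq (by linarith [hr.2])
  rw [intervalIntegral_integral_swap hint]
  simp only [intervalIntegral.integral_comp_add_right]

/-- Moving the starting point `σ` of a threshold rule to `τ` does not decrease the expected
penalty in excess of `β`, if `σ` separates `g < β` from `g ≥ β`, where `g u = E[q (u + V)]`. -/
lemma Monotone.integral_threshold_nonneg {Ω : Type*} [MeasurableSpace Ω] {μ : Measure Ω}
    [IsProbabilityMeasure μ] {q : ℝ → ℝ} (hq : Monotone q) {V : Ω → ℝ} (hV : Measurable V)
    (hint : ∀ s : ℝ, 0 ≤ s → Integrable (fun ω => q (s + V ω)) μ) {β σ τ s : ℝ}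
    (hs : 0 ≤ s) (hσ : ∀ u, 0 ≤ u → σ < u → β ≤ ∫ ω, q (u + V ω) ∂μ)
    (hσ' : ∀ u, 0 ≤ u → u < σ → ∫ ω, q (u + V ω) ∂μ ≤ β) :
    0 ≤ ∫ ω, (∫ t in (max s σ + V ω)..(max s τ + V ω), (q t - β)) ∂μ := by
  have hqβ : Monotone fun t => q t - β := fun a b h => sub_le_sub_right (hq h) β
  have hintβ : ∀ u : ℝ, 0 ≤ u → Integrable (fun ω => q (u + V ω) - β) μ :=
    fun u hu => (hint u hu).sub (integrable_const _)
  have hval : ∀ u : ℝ, 0 ≤ u → ∫ ω, (q (u + V ω) - β) ∂μ = (∫ ω, q (u + V ω) ∂μ) - β := by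
    intro u hu
    rw [integral_sub (hint u hu) (integrable_const _)]
    simp
  have h0 : ∀ r, 0 ≤ max s r := fun r => hs.trans (le_max_left _ _)
  rcases le_total σ τ with h | h
  · have hm : max s σ ≤ max s τ := max_le_max le_rfl h
    rw [hqβ.integral_intervalIntegral_add hV hm (hintβ _ (h0 _)) (hintβ _ (h0 _)),
      intervalIntegral.integral_of_le hm]
    refine setIntegral_nonneg measurableSet_Ioc fun u hu => ?_
    have hu0 : 0 ≤ u := (h0 σ).trans hu.1.le
    rw [hval u hu0]
    exact sub_nonneg.2 (hσ u hu0 ((le_max_right _ _).trans_lt hu.1))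
  · have hm : max s τ ≤ max s σ := max_le_max le_rfl h
    simp_rw [intervalIntegral.integral_symm (max s τ + V _)]
    rw [integral_neg, hqβ.integral_intervalIntegral_add hV hm (hintβ _ (h0 _)) (hintβ _ (h0 _)),
      intervalIntegral.integral_of_le hm, integral_Ioc_eq_integral_Ioo, neg_nonneg]
    refine setIntegral_nonpos measurableSet_Ioo fun u hu => ?_
    have hu0 : 0 ≤ u := (h0 τ).trans hu.1.le
    rw [hval u hu0]
    refine sub_nonpos.2 (hσ' u hu0 ?_)
    rcases lt_max_iff.1 hu.2 with h1 | h1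
    · exact absurd ((le_max_left s τ).trans_lt hu.1) h1.not_gt
    · exact h1

/-- The version of `Monotone.integral_threshold_nonneg` with `s` replaced by a random variable
independent of `V`. -/
lemma Monotone.integral_threshold_nonneg_of_indepFun {Ω : Type*} [MeasurableSpace Ω]
    {μ : Measure Ω} [IsProbabilityMeasure μ] {q : ℝ → ℝ} (hq : Monotone q) {S V : Ω → ℝ}
    (hS : Measurable S) (hV : Measurable V) (hSpos : ∀ ω, 0 ≤ S ω) (hSV : IndepFun S V μ)
    (hint : ∀ s : ℝ, 0 ≤ s → Integrable (fun ω => q (s + V ω)) μ) {β σ τ : ℝ}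
    (hσ : ∀ u, 0 ≤ u → σ < u → β ≤ ∫ ω, q (u + V ω) ∂μ)
    (hσ' : ∀ u, 0 ≤ u → u < σ → ∫ ω, q (u + V ω) ∂μ ≤ β)
    (hdiff : Integrable
      (fun ω => ∫ t in (max (S ω) σ + V ω)..(max (S ω) τ + V ω), (q t - β)) μ) :
    0 ≤ ∫ ω, (∫ t in (max (S ω) σ + V ω)..(max (S ω) τ + V ω), (q t - β)) ∂μ := by
  have hqβ : Monotone fun t => q t - β := fun a b h => sub_le_sub_right (hq h) β
  have hprod := hSV.map_prod_eq_prod_map_map hS.aemeasurable hV.aemeasurable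
  have := Measure.isProbabilityMeasure_map (μ := μ) hS.aemeasurable
  have := Measure.isProbabilityMeasure_map (μ := μ) hV.aemeasurable
  set Φ : ℝ × ℝ → ℝ := fun r => ∫ t in (max r.1 σ + r.2)..(max r.1 τ + r.2), (q t - β) with hΦ
  have hΦm : Measurable Φ := hqβ.measurable_intervalIntegral (by fun_prop) (by fun_prop)
  have hSVm : AEMeasurable (fun ω => (S ω, V ω)) μ := (hS.prodMk hV).aemeasurable
  have h1 : Integrable Φ ((μ.map S).prod (μ.map V)) := by
    rw [← hprod, integrable_map_measure hΦm.aestronglyMeasurable hSVm]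
    exact hdiff
  have h2 : ∫ ω, (∫ t in (max (S ω) σ + V ω)..(max (S ω) τ + V ω), (q t - β)) ∂μ
      = ∫ x, ∫ y, Φ (x, y) ∂(μ.map V) ∂(μ.map S) := by
    rw [← integral_prod _ h1, ← hprod, integral_map hSVm hΦm.aestronglyMeasurable]
  rw [h2]
  refine integral_nonneg_of_ae ?_
  have hpos : ∀ᵐ x ∂(μ.map S), 0 ≤ x :=
    (ae_map_iff hS.aemeasurable measurableSet_Ici).2 (Filter.Eventually.of_forall hSpos)
  filter_upwards [hpos] with x hx
  have h3 : ∫ y, Φ (x, y) ∂(μ.map V) = ∫ ω, Φ (x, V ω) ∂μ :=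
    integral_map hV.aemeasurable (hΦm.comp (by fun_prop)).aestronglyMeasurable
  rw [h3]
  exact hq.integral_threshold_nonneg hV hint hx hσ hσ'

/-- Hitting a level of a monotone function after time `s`. -/
lemma MonotoneOn.sInf_add_eq_max_sub {g : ℝ → ℝ} (hg : MonotoneOn g (Set.Ici 0)) {β s : ℝ}
    (hs : 0 ≤ s) (hne : {u : ℝ | 0 ≤ u ∧ β ≤ g u}.Nonempty) :
    sInf {z : ℝ | 0 ≤ z ∧ β ≤ g (s + z)} = max s (sInf {u : ℝ | 0 ≤ u ∧ β ≤ g u}) - s := by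
  set σ := sInf {u : ℝ | 0 ≤ u ∧ β ≤ g u} with hσ
  have hbdd : ∀ P : ℝ → Prop, BddBelow {u : ℝ | 0 ≤ u ∧ P u} :=
    fun _ => ⟨0, fun _ hu => hu.1⟩
  obtain ⟨u, hu0, hu⟩ := id hne
  apply le_antisymm
  · refine le_of_forall_pos_le_add fun ε hε => csInf_le (hbdd fun z => β ≤ g (s + z)) ⟨?_, ?_⟩
    · linarith [le_max_left s σ]
    · have hlt : σ < max s σ + ε := by linarith [le_max_right s σ]
      obtain ⟨v, ⟨hv0, hv⟩, hvlt⟩ := exists_lt_of_csInf_lt hne hlt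
      rw [show s + (max s σ - s + ε) = max s σ + ε by ring]
      exact hv.trans (hg hv0 (hv0.trans hvlt.le) hvlt.le)
  · refine le_csInf ⟨u, hu0, hu.trans (hg hu0 (add_nonneg hs hu0) (by linarith))⟩ ?_
    rintro z ⟨hz0, hz⟩
    have h1 : σ ≤ s + z := csInf_le (hbdd fun u => β ≤ g u) ⟨add_nonneg hs hz0, hz⟩
    have h2 : max s σ ≤ s + z := max_le (by linarith) h1
    linarith

/-- A lower envelope of affine functions `β ↦ A τ - β * B τ` with slopes bounded away from zero,
attained at `T β`, has exactly one root. -/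
lemma existsUnique_root_of_envelope {A B T : ℝ → ℝ} {I : Set ℝ} [I.OrdConnected]
    {l r : ℝ} (hl : IsLeast I l) (hr : r ∈ I)
    (hT0 : ∀ β ∈ I, 0 ≤ T β) (hT : MonotoneOn T I) (hB : MonotoneOn B (Set.Ici 0))
    (hB0 : 0 < B 0)
    (hmin : ∀ β ∈ I, ∀ τ, 0 ≤ τ → A (T β) - β * B (T β) ≤ A τ - β * B τ)
    (hfl : 0 ≤ A (T l) - l * B (T l)) (hfr : A 0 - r * B 0 ≤ 0) :
    ∃! β, β ∈ I ∧ A (T β) - β * B (T β) = 0 := by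
  set F : ℝ → ℝ := fun β => A (T β) - β * B (T β) with hF
  have hBpos : ∀ β ∈ I, 0 < B (T β) := fun β hβ =>
    hB0.trans_le (hB (Set.mem_Ici.2 le_rfl) (hT0 β hβ) (hT0 β hβ))
  have hanti : StrictAntiOn F I := by
    intro a ha b hb hab
    have h1 := hmin b hb (T a) (hT0 a ha)
    have h2 := mul_pos (sub_pos.2 hab) (hBpos a ha)
    simp only [hF]
    linarith
  have hsub : Set.Icc l r ⊆ I := Set.OrdConnected.out ‹_› hl.1 hr
  have hlip : ∀ a ∈ Set.Icc l r, ∀ b ∈ Set.Icc l r, a ≤ b → F a - F b ≤ B (T r) * (b - a) := by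
    intro a ha b hb hab
    have h1 := hmin a (hsub ha) (T b) (hT0 b (hsub hb))
    have h2 : B (T b) ≤ B (T r) :=
      hB (hT0 b (hsub hb)) (hT0 r hr) (hT (hsub hb) hr hb.2)
    have h3 := mul_le_mul_of_nonneg_right h2 (sub_nonneg.2 hab)
    simp only [hF]
    linarith
  have hcont : ContinuousOn F (Set.Icc l r) := by
    refine (LipschitzOnWith.of_dist_le_mul (K := (B (T r)).toNNReal) ?_).continuousOn
    intro a ha b hb
    rw [Real.coe_toNNReal _ (hBpos r hr).le, Real.dist_eq, Real.dist_eq]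
    rcases le_total a b with h | h
    · have h1 := hanti.antitoneOn (hsub ha) (hsub hb) h
      rw [abs_of_nonneg (sub_nonneg.2 h1), abs_sub_comm, abs_of_nonneg (sub_nonneg.2 h)]
      exact hlip a ha b hb h
    · have h1 := hanti.antitoneOn (hsub hb) (hsub ha) h
      rw [abs_sub_comm, abs_of_nonneg (sub_nonneg.2 h1), abs_of_nonneg (sub_nonneg.2 h)]
      exact hlip b hb a ha h
  obtain ⟨β, hβ, hβ0⟩ := intermediate_value_Icc' (hl.2 hr) hcont
    ⟨(hmin r hr 0 le_rfl).trans hfr, hfl⟩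
  refine ⟨β, ⟨hsub hβ, hβ0⟩, fun γ hγ => ?_⟩
  exact hanti.injOn hγ.1 (hsub hβ) (hγ.2.trans hβ0.symm)

/-- `stmt9` for a penalty that is monotone on the whole line. -/
lemma Monotone.existsUnique_threshold_root {Ω : Type*} [MeasurableSpace Ω] (μ : Measure Ω)
    [IsProbabilityMeasure μ] (q : ℝ → ℝ) (hq : Monotone q) (pbar : EReal)
    (hpbar : Filter.Tendsto (fun t : ℝ => ((q t : ℝ) : EReal)) Filter.atTop (nhds pbar))
    (hplt : ∀ t : ℝ, 0 ≤ t → ((q t : ℝ) : EReal) < pbar)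
    (Y X V : Ω → ℝ) (hY : Measurable Y) (hX : Measurable X) (hV : Measurable V)
    (hYpos : ∀ ω, 0 ≤ Y ω) (hXpos : ∀ ω, 0 ≤ X ω) (hVpos : ∀ ω, 0 ≤ V ω)
    (hYint : Integrable Y μ) (hXint : Integrable X μ) (hVint : Integrable V μ)
    (hindep : IndepFun (fun ω => (Y ω, X ω)) V μ)
    (hmean : 0 < ∫ ω, (X ω + V ω) ∂μ)
    (hint1 : ∀ z : ℝ, 0 ≤ z →
      Integrable (fun ω => ∫ t in Y ω..(Y ω + X ω + z + V ω), |q t|) μ)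
    (hint2 : ∀ z : ℝ, 0 ≤ z → Integrable (fun ω => q (Y ω + X ω + z + V ω)) μ)
    (Z : ℝ → Ω → ℝ)
    (hZ : ∀ β ω, Z β ω = sInf {z : ℝ | 0 ≤ z ∧ β ≤ ∫ ω', q (Y ω + X ω + z + V ω') ∂μ})
    (f : ℝ → ℝ)
    (hf : ∀ β, f β = (∫ ω, (∫ t in Y ω..(Y ω + X ω + Z β ω + V ω), q t) ∂μ)
      - β * ∫ ω, (X ω + Z β ω + V ω) ∂μ) :
    ∃! β : ℝ, (q 0 ≤ β ∧ ((β : ℝ) : EReal) < pbar) ∧ f β = 0 := by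
  set S : Ω → ℝ := fun ω => Y ω + X ω with hSdef
  have hS : Measurable S := hY.add hX
  have hSpos : ∀ ω, 0 ≤ S ω := fun ω => add_nonneg (hYpos ω) (hXpos ω)
  have hSint : Integrable S μ := hYint.add hXint
  have hSV : IndepFun S V μ :=
    hindep.comp (φ := fun r : ℝ × ℝ => r.1 + r.2) (ψ := id) (by fun_prop) measurable_id
  have hgint : ∀ s : ℝ, 0 ≤ s → Integrable (fun ω => q (s + V ω)) μ :=
    fun s hs => hq.integrable_comp_add hS hV hVpos hSV hint2 hs
  set g : ℝ → ℝ := fun u => ∫ ω, q (u + V ω) ∂μ with hg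
  have hgmono : MonotoneOn g (Set.Ici 0) := fun a ha b hb hab =>
    integral_mono (hgint a ha) (hgint b hb) fun ω => hq (by linarith)
  have hqg : ∀ u, 0 ≤ u → q u ≤ g u := by
    intro u hu
    calc q u = ∫ _, q u ∂μ := by simp
      _ ≤ g u := integral_mono (integrable_const _) (hgint u hu) fun ω => hq (by linarith [hVpos ω])
  set I : Set ℝ := {β | q 0 ≤ β ∧ (β : EReal) < pbar} with hI
  have hlevel : ∀ β ∈ I, ∃ u, 0 ≤ u ∧ β ≤ g u := by
    intro β hβ
    obtain ⟨u, hu, hu0⟩ := ((hpbar.eventually_const_lt hβ.2).and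
      (Filter.eventually_ge_atTop 0)).exists
    exact ⟨u, hu0, (EReal.coe_lt_coe_iff.1 hu).le.trans (hqg u hu0)⟩
  set T : ℝ → ℝ := fun β => sInf {u : ℝ | 0 ≤ u ∧ β ≤ g u} with hT
  have hbdd : ∀ β, BddBelow {u : ℝ | 0 ≤ u ∧ β ≤ g u} := fun β => ⟨0, fun u hu => hu.1⟩
  have hT0 : ∀ β, 0 ≤ T β := fun β => Real.sInf_nonneg fun u hu => hu.1
  have hTmono : MonotoneOn T I := fun a _ b hb hab =>
    csInf_le_csInf (hbdd a) (hlevel b hb) fun u hu => ⟨hu.1, hab.trans hu.2⟩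
  have hZT : ∀ β ∈ I, ∀ ω, S ω + Z β ω = max (S ω) (T β) := by
    intro β hβ ω
    have h1 : Z β ω = sInf {z : ℝ | 0 ≤ z ∧ β ≤ g (S ω + z)} := hZ β ω
    rw [h1, hgmono.sInf_add_eq_max_sub (hSpos ω) (hlevel β hβ)]
    ring
  have hYS : ∀ τ ω, Y ω ≤ max (S ω) τ + V ω := fun τ ω => by
    have h1 := le_max_left (S ω) τ
    have h2 : S ω = Y ω + X ω := rfl
    linarith [hXpos ω, hVpos ω]
  have hAint : ∀ τ, 0 ≤ τ →
      Integrable (fun ω => ∫ t in Y ω..(max (S ω) τ + V ω), q t) μ := by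
    intro τ hτ
    refine (hint1 τ hτ).mono'
      (hq.measurable_intervalIntegral hY (by fun_prop)).aestronglyMeasurable
      (Filter.Eventually.of_forall fun ω => ?_)
    refine (intervalIntegral.abs_integral_le_integral_abs (hYS τ ω)).trans ?_
    refine intervalIntegral.integral_mono_interval le_rfl (hYS τ ω) ?_
      (Filter.Eventually.of_forall fun t => abs_nonneg (q t)) hq.intervalIntegrable.abs
    have h1 : max (S ω) τ ≤ S ω + τ := max_le (by linarith) (by linarith [hSpos ω])
    exact add_le_add_left h1 _
  have hBint : ∀ τ, Integrable (fun ω => max (S ω) τ - Y ω + V ω) μ := fun τ =>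
    ((hSint.sup (integrable_const τ)).sub hYint).add hVint
  set A : ℝ → ℝ := fun τ => ∫ ω, (∫ t in Y ω..(max (S ω) τ + V ω), q t) ∂μ with hA
  set B : ℝ → ℝ := fun τ => ∫ ω, (max (S ω) τ - Y ω + V ω) ∂μ with hB
  have hfAB : ∀ β ∈ I, f β = A (T β) - β * B (T β) := by
    intro β hβ
    have hW : ∀ ω, Y ω + X ω + Z β ω = max (S ω) (T β) := hZT β hβ
    have hW' : ∀ ω, X ω + Z β ω + V ω = max (S ω) (T β) - Y ω + V ω := fun ω => by
      rw [← hW ω]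
      ring
    simp only [hf, hW, hW', hA, hB]
  have hexcess : ∀ β a b : ℝ, ∫ t in a..b, (q t - β) = (∫ t in a..b, q t) - β * (b - a) := by
    intro β a b
    rw [intervalIntegral.integral_sub hq.intervalIntegrable intervalIntegrable_const]
    simp [mul_comm]
  have hAB : ∀ β τ, 0 ≤ τ → A τ - β * B τ
      = ∫ ω, (∫ t in Y ω..(max (S ω) τ + V ω), (q t - β)) ∂μ := by
    intro β τ hτ
    simp only [hA, hB]
    rw [← integral_const_mul, ← integral_sub (hAint τ hτ) ((hBint τ).const_mul β)]
    refine integral_congr_ae (Filter.Eventually.of_forall fun ω => ?_)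
    simp only [hexcess]
    ring
  have hexcessInt : ∀ β τ, 0 ≤ τ →
      Integrable (fun ω => ∫ t in Y ω..(max (S ω) τ + V ω), (q t - β)) μ := by
    intro β τ hτ
    refine ((hAint τ hτ).sub ((hBint τ).const_mul β)).congr
      (Filter.Eventually.of_forall fun ω => ?_)
    simp only [hexcess, Pi.sub_apply]
    ring
  have hmin : ∀ β ∈ I, ∀ τ, 0 ≤ τ → A (T β) - β * B (T β) ≤ A τ - β * B τ := by
    intro β hβ τ hτ
    have hqβ : Monotone fun t => q t - β := fun a b h => sub_le_sub_right (hq h) β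
    have heq : ∀ ω, (∫ t in Y ω..(max (S ω) τ + V ω), (q t - β))
        - (∫ t in Y ω..(max (S ω) (T β) + V ω), (q t - β))
        = ∫ t in (max (S ω) (T β) + V ω)..(max (S ω) τ + V ω), (q t - β) := fun ω =>
      intervalIntegral.integral_interval_sub_left hqβ.intervalIntegrable hqβ.intervalIntegrable
    have hdiff := (hexcessInt β τ hτ).sub (hexcessInt β (T β) (hT0 β))
    have hpos := hq.integral_threshold_nonneg_of_indepFun (σ := T β) (τ := τ) (β := β)
      hS hV hSpos hSV hgint
      (fun u hu0 hu => by
        obtain ⟨v, ⟨hv0, hv⟩, hvu⟩ := exists_lt_of_csInf_lt (hlevel β hβ) hu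
        exact hv.trans (hgmono hv0 hu0 hvu.le))
      (fun u hu0 hu => by
        by_contra! h
        exact hu.not_ge (csInf_le (hbdd β) ⟨hu0, h.le⟩))
      (hdiff.congr (Filter.Eventually.of_forall heq))
    rw [hAB β _ (hT0 β), hAB β τ hτ, ← sub_nonneg,
      ← integral_sub (hexcessInt β τ hτ) (hexcessInt β (T β) (hT0 β))]
    simpa only [heq] using hpos
  have hBmono : MonotoneOn B (Set.Ici 0) := fun a _ b _ hab =>
    integral_mono (hBint a) (hBint b) fun ω => by
      have := max_le_max (le_refl (S ω)) hab
      simp only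
      linarith
  have hB0 : B 0 = ∫ ω, (X ω + V ω) ∂μ := by
    refine integral_congr_ae (Filter.Eventually.of_forall fun ω => ?_)
    have h1 : S ω = Y ω + X ω := rfl
    simp only [max_eq_left (hSpos ω)]
    rw [h1]
    ring
  have hB0pos : 0 < B 0 := hB0 ▸ hmean
  have hl : IsLeast I (q 0) := ⟨⟨le_rfl, hplt 0 le_rfl⟩, fun β hβ => hβ.1⟩
  have hratio : ((A 0 / B 0 : ℝ) : EReal) < pbar := by
    induction pbar with
    | top => exact EReal.coe_lt_top _
    | bot => exact absurd (hplt 0 le_rfl) not_lt_bot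
    | coe r =>
      rw [EReal.coe_lt_coe_iff, div_lt_iff₀ hB0pos]
      by_contra! hle
      have hneg : ∀ ω, (∫ t in Y ω..(max (S ω) 0 + V ω), (q t - r)) ≤ 0 := fun ω => by
        rw [intervalIntegral.integral_of_le (hYS 0 ω)]
        exact setIntegral_nonpos measurableSet_Ioc fun t ht =>
          sub_nonpos.2 (EReal.coe_lt_coe_iff.1 (hplt t ((hYpos ω).trans ht.1.le))).le
      have hzero : ∫ ω, -(∫ t in Y ω..(max (S ω) 0 + V ω), (q t - r)) ∂μ = 0 := by
        rw [integral_neg, neg_eq_zero]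
        refine le_antisymm (integral_nonpos hneg) ?_
        rw [← hAB r 0 le_rfl]
        linarith
      rw [integral_eq_zero_iff_of_nonneg (fun ω => neg_nonneg.2 (hneg ω))
        (hexcessInt r 0 le_rfl).neg] at hzero
      have hXV : ∫ ω, (X ω + V ω) ∂μ = 0 := by
        refine integral_eq_zero_of_ae ?_
        filter_upwards [hzero] with ω hω
        by_contra hne
        have hlt : Y ω < max (S ω) 0 + V ω := by
          have h1 : 0 < X ω + V ω :=
            lt_of_le_of_ne (add_nonneg (hXpos ω) (hVpos ω)) (Ne.symm hne)
          have h2 : S ω = Y ω + X ω := rfl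
          linarith [le_max_left (S ω) 0]
        have hpos : 0 < ∫ t in Y ω..(max (S ω) 0 + V ω), (r - q t) :=
          intervalIntegral.intervalIntegral_pos_of_pos_on
            (intervalIntegrable_const.sub hq.intervalIntegrable)
            (fun t ht => sub_pos.2 (EReal.coe_lt_coe_iff.1 (hplt t ((hYpos ω).trans ht.1.le)))) hlt
        have h3 : ∫ t in Y ω..(max (S ω) 0 + V ω), (r - q t)
            = -(∫ t in Y ω..(max (S ω) 0 + V ω), (q t - r)) := by
          rw [← intervalIntegral.integral_neg]
          simp only [neg_sub]
        rw [h3] at hpos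
        exact hpos.ne' hω
      exact hmean.ne' hXV
  have hr : max (q 0) (A 0 / B 0) ∈ I := by
    refine ⟨le_max_left _ _, ?_⟩
    rcases max_choice (q 0) (A 0 / B 0) with h | h
    · rw [h]; exact hl.1.2
    · rw [h]; exact hratio
  have : I.OrdConnected := ⟨fun a ha b hb c hc =>
    ⟨ha.1.trans hc.1, (EReal.coe_le_coe_iff.2 hc.2).trans_lt hb.2⟩⟩
  have hfl : 0 ≤ A (T (q 0)) - q 0 * B (T (q 0)) := by
    rw [hAB _ _ (hT0 _)]
    exact integral_nonneg fun ω => intervalIntegral.integral_nonneg (hYS _ ω) fun t ht =>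
      sub_nonneg.2 (hq ((hYpos ω).trans ht.1))
  have hfr : A 0 - max (q 0) (A 0 / B 0) * B 0 ≤ 0 :=
    sub_nonpos.2 ((div_le_iff₀ hB0pos).1 (le_max_right _ _))
  obtain ⟨β, ⟨hβI, hβ⟩, huniq⟩ := existsUnique_root_of_envelope hl hr (fun β _ => hT0 β) hTmono
    hBmono hB0pos hmin hfl hfr
  exact ⟨β, ⟨hβI, (hfAB β hβI).trans hβ⟩, fun γ hγ =>
    huniq γ ⟨hγ.1, (hfAB γ hγ.1).symm.trans hγ.2⟩⟩

/-- Paper's Lemma 2, part (2): existence and uniqueness of the root `β ∈ [p(0), p̄) ∩ ℝ`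
of `f(β) = E[∫_Y^{Y+X+Z(β)+Y'} p(t) dt] − β E[X + Z(β) + Y'] = 0`, the root being the
optimal average age penalty. -/
theorem stmt9 {Ω : Type*} [MeasurableSpace Ω] (μ : Measure Ω) [IsProbabilityMeasure μ]
    (p : ℝ → ℝ) (hp : MonotoneOn p (Set.Ici 0)) (hpm : Measurable p)
    (pbar : EReal)
    (hpbar : Filter.Tendsto (fun t : ℝ => ((p t : ℝ) : EReal)) Filter.atTop (nhds pbar))
    (hplt : ∀ t : ℝ, 0 ≤ t → ((p t : ℝ) : EReal) < pbar)
    (Y X Y' : Ω → ℝ) (hY : Measurable Y) (hX : Measurable X) (hY' : Measurable Y')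
    (hYpos : ∀ ω, 0 ≤ Y ω) (hXpos : ∀ ω, 0 ≤ X ω) (hY'pos : ∀ ω, 0 ≤ Y' ω)
    (hYint : Integrable Y μ) (hXint : Integrable X μ) (hY'int : Integrable Y' μ)
    (hindep : IndepFun (fun ω => (Y ω, X ω)) Y' μ)
    (hmean : 0 < ∫ ω, (X ω + Y' ω) ∂μ)
    (hint1 : ∀ z : ℝ, 0 ≤ z →
      Integrable (fun ω => ∫ t in Y ω..(Y ω + X ω + z + Y' ω), |p t|) μ)
    (hint2 : ∀ z : ℝ, 0 ≤ z → Integrable (fun ω => p (Y ω + X ω + z + Y' ω)) μ)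
    (Z : ℝ → Ω → ℝ)
    (hZ : ∀ β ω, Z β ω = sInf {z : ℝ | 0 ≤ z ∧ β ≤ ∫ ω', p (Y ω + X ω + z + Y' ω') ∂μ})
    (f : ℝ → ℝ)
    (hf : ∀ β, f β = (∫ ω, (∫ t in Y ω..(Y ω + X ω + Z β ω + Y' ω), p t) ∂μ)
      - β * ∫ ω, (X ω + Z β ω + Y' ω) ∂μ) :
    ∃! β : ℝ, (p 0 ≤ β ∧ ((β : ℝ) : EReal) < pbar) ∧ f β = 0 := by
  set q : ℝ → ℝ := fun t => p (max t 0) with hqdef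
  have hq : Monotone q := fun a b hab =>
    hp (Set.mem_Ici.2 (le_max_right _ _)) (Set.mem_Ici.2 (le_max_right _ _))
      (max_le_max hab le_rfl)
  have hqp : ∀ t, 0 ≤ t → q t = p t := fun t ht => by simp only [hqdef, max_eq_left ht]
  have hint : ∀ (h : ℝ → ℝ) (ω : Ω) (z : ℝ), 0 ≤ z →
      ∫ t in Y ω..(Y ω + X ω + z + Y' ω), h (q t)
        = ∫ t in Y ω..(Y ω + X ω + z + Y' ω), h (p t) := by
    intro h ω z hz
    refine intervalIntegral.integral_congr fun t ht => ?_
    rw [Set.uIcc_of_le (by linarith [hXpos ω, hY'pos ω])] at ht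
    simp only [hqp t ((hYpos ω).trans ht.1)]
  have hval : ∀ (ω ω' : Ω) (z : ℝ), 0 ≤ z →
      q (Y ω + X ω + z + Y' ω') = p (Y ω + X ω + z + Y' ω') := fun ω ω' z hz =>
    hqp _ (by linarith [hYpos ω, hXpos ω, hY'pos ω'])
  rw [← hqp 0 le_rfl]
  refine hq.existsUnique_threshold_root μ q pbar ?_ (fun t ht => hqp t ht ▸ hplt t ht)
    Y X Y' hY hX hY' hYpos hXpos hY'pos hYint hXint hY'int hindep hmean ?_ ?_ Z ?_ f ?_
  · refine hpbar.congr' ?_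
    filter_upwards [Filter.eventually_ge_atTop 0] with t ht
    rw [hqp t ht]
  · intro z hz
    exact (hint1 z hz).congr (Filter.Eventually.of_forall fun ω => (hint abs ω z hz).symm)
  · intro z hz
    exact (hint2 z hz).congr (Filter.Eventually.of_forall fun ω => (hval ω ω z hz).symm)
  · intro β ω
    rw [hZ]
    congr 1
    ext z
    refine and_congr_right fun hz => ?_
    simp only [hval ω _ z hz]
  · intro β
    have hZ0 : ∀ ω, 0 ≤ Z β ω := fun ω => hZ β ω ▸ Real.sInf_nonneg fun z hz => hz.1
    rw [hf]
    congr 1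
    exact integral_congr_ae (Filter.Eventually.of_forall fun ω => (hint id ω _ (hZ0 ω)).symm)
end

section
/- Let p : [0,∞) → ℝ be nondecreasing, Y a nonnegative integrable random variable with E[∫_δ^{δ+w+Y}|p(t)|dt] < ∞ and E[|p(δ+w+Y)|] < ∞ for all w ≥ 0, let δ ≥ 0 and β ∈ ℝ, and suppose the set S = { w ≥ 0 : E[ p(δ + w + Y) ] ≥ β } is nonempty, with w* = inf S. Then w* minimizes the per-sample cost: for every w ≥ 0, E[ ∫_δ^{δ+w+Y} p(t) dt ] − β·( w + E[Y] ) ≥ E[ ∫_δ^{δ+w*+Y} p(t) dt ] − β·( w* + E[Y] ). (The threshold-optimality fact underlying the paper's optimal waiting time (20) and the proof of Lemma 4 in Appendix E.) -/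
open MeasureTheory

open Filter Topology

/-- The average of a monotone function over an interval lies between its end values. -/
theorem MonotoneOn.sub_mul_le_intervalIntegral_le {f : ℝ → ℝ} {a b : ℝ} (hab : a ≤ b)
    (hf : MonotoneOn f (Set.Icc a b)) :
    (b - a) * f a ≤ ∫ t in a..b, f t ∧ ∫ t in a..b, f t ≤ (b - a) * f b := by
  have hfi : IntervalIntegrable f volume a b :=
    MonotoneOn.intervalIntegrable (by rwa [Set.uIcc_of_le hab])
  constructor
  · have h := intervalIntegral.integral_mono_on hab intervalIntegrable_const hfi
      fun t ht => hf (Set.left_mem_Icc.2 hab) ht ht.1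
    simpa using h
  · have h := intervalIntegral.integral_mono_on hab hfi intervalIntegrable_const
      fun t ht => hf ht (Set.right_mem_Icc.2 hab) ht.2
    simpa using h

theorem MonotoneOn.intervalIntegrable_of_nonneg {p : ℝ → ℝ} (hp : MonotoneOn p (Set.Ici 0))
    {a b : ℝ} (ha : 0 ≤ a) (hb : 0 ≤ b) : IntervalIntegrable p volume a b :=
  MonotoneOn.intervalIntegrable <| hp.mono fun _ ht => (le_min ha hb).trans ht.1

/-- The primitive of a function monotone on `[0, ∞)`, composed with a nonnegative random
variable, is measurable. -/
theorem MonotoneOn.aestronglyMeasurable_intervalIntegral_comp {Ω : Type*} [MeasurableSpace Ω]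
    {μ : Measure Ω} {p : ℝ → ℝ} (hp : MonotoneOn p (Set.Ici 0)) {δ : ℝ} (hδ : 0 ≤ δ)
    {X : Ω → ℝ} (hX : Measurable X) (hX0 : ∀ ω, 0 ≤ X ω) :
    AEStronglyMeasurable (fun ω => ∫ t in δ..X ω, p t) μ := by
  have hq : Monotone fun t => p (max t 0) := fun s t hst =>
    hp (le_max_right s 0) (le_max_right t 0) (max_le_max_right 0 hst)
  have hcont : Continuous fun x => ∫ t in δ..x, p (max t 0) :=
    intervalIntegral.continuous_primitive (fun _ _ => hq.intervalIntegrable) δ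
  have heq : (fun ω => ∫ t in δ..X ω, p t) = fun ω => ∫ t in δ..X ω, p (max t 0) := by
    funext ω
    refine intervalIntegral.integral_congr fun t ht => ?_
    have ht0 : 0 ≤ t := (le_min hδ (hX0 ω)).trans ht.1
    simp only [max_eq_left ht0]
  rw [heq]
  exact (hcont.measurable.comp hX).aestronglyMeasurable

/-- A function whose increments are controlled by slopes `m` attains the minimum of
`G w - β * w` over `w ≥ 0` at the threshold where `m` crosses `β`. -/
theorem sub_mul_sInf_le_of_slope_bounds {G m : ℝ → ℝ} {β : ℝ}
    (hlow : ∀ a b, 0 ≤ a → a ≤ b → (b - a) * m a ≤ G b - G a)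
    (hup : ∀ a b, 0 ≤ a → a ≤ b → G b - G a ≤ (b - a) * m b)
    (hm : MonotoneOn m (Set.Ici 0))
    (hS : {w : ℝ | 0 ≤ w ∧ β ≤ m w}.Nonempty) {w : ℝ} (hw : 0 ≤ w) :
    G (sInf {w : ℝ | 0 ≤ w ∧ β ≤ m w}) - β * sInf {w : ℝ | 0 ≤ w ∧ β ≤ m w}
      ≤ G w - β * w := by
  have hbdd : BddBelow {w : ℝ | 0 ≤ w ∧ β ≤ m w} := ⟨0, fun _ hx => hx.1⟩
  set s := sInf {w : ℝ | 0 ≤ w ∧ β ≤ m w}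
  have hs0 : 0 ≤ s := le_csInf hS fun _ hx => hx.1
  have hcont : Tendsto (fun c => (w - c) * β + (c - s) * m s) (𝓝 s)
      (𝓝 ((w - s) * β + (s - s) * m s)) :=
    Continuous.tendsto (by fun_prop) s
  suffices h : (w - s) * β + (s - s) * m s ≤ G w - G s by linarith
  rcases lt_trichotomy w s with hws | rfl | hsw
  · refine le_of_tendsto (hcont.mono_left (nhdsWithin_le_nhds : 𝓝[<] s ≤ 𝓝 s)) ?_
    filter_upwards [Ioo_mem_nhdsLT hws] with c hc
    have hc0 : 0 ≤ c := hw.trans hc.1.le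
    have hmc : m c < β := not_le.1 fun h => notMem_of_lt_csInf hc.2 hbdd ⟨hc0, h⟩
    have h1 := hup w c hw hc.1.le
    have h2 := hup c s hc0 hc.2.le
    have h3 := mul_le_mul_of_nonneg_left hmc.le (sub_nonneg.2 hc.1.le)
    linarith
  · simp
  · refine le_of_tendsto (hcont.mono_left (nhdsWithin_le_nhds : 𝓝[>] s ≤ 𝓝 s)) ?_
    filter_upwards [Ioo_mem_nhdsGT hsw] with c hc
    have hc0 : 0 ≤ c := hs0.trans hc.1.le
    obtain ⟨x, hx, hxc⟩ := exists_lt_of_csInf_lt hS hc.1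
    have hmc : β ≤ m c := hx.2.trans (hm hx.1 hc0 hxc.le)
    have h1 := hlow c w hc0 hc.2.le
    have h2 := hlow s c hs0 hc.1.le
    have h3 := mul_le_mul_of_nonneg_left hmc (sub_nonneg.2 hc.2.le)
    linarith

/-- Threshold optimality underlying the paper's optimal waiting time (20) and Lemma 4
(Appendix E): `w* = inf{ w ≥ 0 : E[p(δ + w + Y)] ≥ β }` minimizes the per-sample cost
`w ↦ E[∫_δ^{δ+w+Y} p(t) dt] − β(w + E[Y])` over `w ≥ 0`. -/
theorem stmt13 {Ω : Type*} [MeasurableSpace Ω] (μ : Measure Ω) [IsProbabilityMeasure μ]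
    (p : ℝ → ℝ) (hp : MonotoneOn p (Set.Ici 0)) (hpm : Measurable p)
    (Y : Ω → ℝ) (hY : Measurable Y) (hYpos : ∀ ω, 0 ≤ Y ω) (hYint : Integrable Y μ)
    (δ : ℝ) (hδ : 0 ≤ δ) (β : ℝ)
    (hint1 : ∀ w : ℝ, 0 ≤ w →
      Integrable (fun ω => ∫ t in δ..(δ + w + Y ω), |p t|) μ)
    (hint2 : ∀ w : ℝ, 0 ≤ w → Integrable (fun ω => p (δ + w + Y ω)) μ)
    (hS : ({w : ℝ | 0 ≤ w ∧ β ≤ ∫ ω, p (δ + w + Y ω) ∂μ}).Nonempty)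
    (wstar : ℝ) (hwstar : wstar = sInf {w : ℝ | 0 ≤ w ∧ β ≤ ∫ ω, p (δ + w + Y ω) ∂μ}) :
    ∀ w : ℝ, 0 ≤ w →
      (∫ ω, (∫ t in δ..(δ + w + Y ω), p t) ∂μ) - β * (w + ∫ ω, Y ω ∂μ)
        ≥ (∫ ω, (∫ t in δ..(δ + wstar + Y ω), p t) ∂μ) - β * (wstar + ∫ ω, Y ω ∂μ) := by
  intro w hw
  have hpos : ∀ {a : ℝ}, 0 ≤ a → ∀ ω, 0 ≤ δ + a + Y ω := fun ha ω =>
    add_nonneg (add_nonneg hδ ha) (hYpos ω)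
  have hG : ∀ a, 0 ≤ a → Integrable (fun ω => ∫ t in δ..(δ + a + Y ω), p t) μ := by
    intro a ha
    refine (hint1 a ha).mono
      (hp.aestronglyMeasurable_intervalIntegral_comp hδ (hY.const_add _) (hpos ha)) ?_
    refine Eventually.of_forall fun ω => ?_
    have hle : δ ≤ δ + a + Y ω := by linarith [hYpos ω]
    exact (intervalIntegral.norm_integral_le_integral_norm hle).trans (le_abs_self _)
  have hslope : ∀ a b, 0 ≤ a → a ≤ b → ∀ ω,
      (b - a) * p (δ + a + Y ω) ≤
          (∫ t in δ..(δ + b + Y ω), p t) - ∫ t in δ..(δ + a + Y ω), p t ∧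
        (∫ t in δ..(δ + b + Y ω), p t) - ∫ t in δ..(δ + a + Y ω), p t ≤
          (b - a) * p (δ + b + Y ω) := by
    intro a b ha hab ω
    rw [intervalIntegral.integral_interval_sub_left
      (hp.intervalIntegrable_of_nonneg hδ (hpos (ha.trans hab) ω))
      (hp.intervalIntegrable_of_nonneg hδ (hpos ha ω))]
    have h := MonotoneOn.sub_mul_le_intervalIntegral_le
      (show δ + a + Y ω ≤ δ + b + Y ω by linarith)
      (hp.mono fun t ht => (hpos ha ω).trans ht.1)
    rwa [show δ + b + Y ω - (δ + a + Y ω) = b - a by ring] at h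
  have hmain := sub_mul_sInf_le_of_slope_bounds
    (G := fun a => ∫ ω, (∫ t in δ..(δ + a + Y ω), p t) ∂μ)
    (m := fun a => ∫ ω, p (δ + a + Y ω) ∂μ) (β := β)
    (fun a b ha hab => by
      rw [← integral_sub (hG b (ha.trans hab)) (hG a ha), ← integral_const_mul]
      exact integral_mono ((hint2 a ha).const_mul _) ((hG b (ha.trans hab)).sub (hG a ha))
        fun ω => (hslope a b ha hab ω).1)
    (fun a b ha hab => by
      rw [← integral_sub (hG b (ha.trans hab)) (hG a ha), ← integral_const_mul]
      exact integral_mono ((hG b (ha.trans hab)).sub (hG a ha))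
        ((hint2 b (ha.trans hab)).const_mul _) fun ω => (hslope a b ha hab ω).2)
    (fun a ha b hb hab => integral_mono (hint2 a ha) (hint2 b hb) fun ω =>
      hp (hpos ha ω) (hpos hb ω) (by linarith))
    hS hw
  rw [← hwstar] at hmain
  linarith
end

section
/- Let p : [0,∞) → ℝ be nondecreasing and integrable on bounded intervals, let α ∈ (0,1) and x, y ≥ 0, and assume Σ_{m=1}^∞ α^{m−1} |p(y + m(x+y))| < ∞ and Σ_{m=1}^∞ α^{m−1} ∫_y^{y+m(x+y)} |p(t)| dt < ∞. Then (1−α) · Σ_{m=1}^∞ α^{m−1} ∫_y^{y+m(x+y)} p(t) dt ≤ (x+y) · Σ_{m=1}^∞ α^{m−1} p( y + m(x+y) ). Equivalently, with M geometrically distributed with P(M=m) = α^{m−1}(1−α), E[ ∫_y^{y+M(x+y)} p(t) dt ] ≤ E[ M·(x+y) ] · E[ p( y + M(x+y) ) ]. (The key inequality in the paper's Corollary 3: for constant forward delay y, constant backward delay x and i.i.d. transmission failures, the zero-wait policy is optimal.) -/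
open MeasureTheory

/-- On an interval in `[0, ∞)`, the integral of a nondecreasing function is at most the length of
the interval times the value at the right endpoint. -/
theorem integral_le_mul_right_of_monotoneOn {p : ℝ → ℝ} (hp : MonotoneOn p (Set.Ici 0)) {a b : ℝ}
    (ha : 0 ≤ a) (hab : a ≤ b) (hint : IntervalIntegrable p volume a b) :
    ∫ t in a..b, p t ≤ (b - a) * p b := by
  calc ∫ t in a..b, p t ≤ ∫ _ in a..b, p b :=
        intervalIntegral.integral_mono_on hab hint intervalIntegrable_const fun t ht =>
          hp (ha.trans ht.1) (ha.trans hab) ht.2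
    _ = (b - a) * p b := by rw [intervalIntegral.integral_const, smul_eq_mul]

/-- Key inequality of the paper's Corollary 3 (zero-wait optimality for constant delays):
for a nondecreasing, locally integrable penalty `p`, constant forward delay `y ≥ 0`,
constant backward delay `x ≥ 0`, and failure probability `α ∈ (0,1)`,
`(1−α) Σ_{m≥1} α^{m−1} ∫_y^{y+m(x+y)} p ≤ (x+y) Σ_{m≥1} α^{m−1} p(y + m(x+y))`,
i.e. `E[∫_y^{y+M(x+y)} p(t) dt] ≤ E[M(x+y)] · E[p(y + M(x+y))]` for geometric `M`. -/
theorem stmt15 (p : ℝ → ℝ) (hp : MonotoneOn p (Set.Ici 0))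
    (hloc : ∀ a c : ℝ, IntervalIntegrable p MeasureTheory.volume a c)
    (α x y : ℝ) (hα0 : 0 < α) (hα1 : α < 1) (hx : 0 ≤ x) (hy : 0 ≤ y)
    (hsum1 : Summable fun m : ℕ => α ^ m * |p (y + ((m : ℝ) + 1) * (x + y))|)
    (hsum2 : Summable fun m : ℕ => α ^ m * ∫ t in y..(y + ((m : ℝ) + 1) * (x + y)), |p t|) :
    (1 - α) * ∑' m : ℕ, α ^ m * ∫ t in y..(y + ((m : ℝ) + 1) * (x + y)), p t
      ≤ (x + y) * ∑' m : ℕ, α ^ m * p (y + ((m : ℝ) + 1) * (x + y)) := by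
  have hd : 0 ≤ x + y := add_nonneg hx hy
  set G : ℕ → ℝ := fun k => ∫ t in y..(y + (k : ℝ) * (x + y)), p t with hG
  have hG0 : G 0 = 0 := by simp [hG]
  have hGs (m : ℕ) : ∫ t in y..(y + ((m : ℝ) + 1) * (x + y)), p t = G (m + 1) := by simp [hG]
  simp only [hGs]
  have hstep (m : ℕ) : G (m + 1) - G m ≤ (x + y) * p (y + ((m : ℝ) + 1) * (x + y)) := by
    have hsub : G (m + 1) - G m =
        ∫ t in (y + (m : ℝ) * (x + y))..(y + ((m : ℝ) + 1) * (x + y)), p t := by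
      rw [← hGs]
      exact intervalIntegral.integral_interval_sub_left (hloc _ _) (hloc _ _)
    rw [hsub]
    refine (integral_le_mul_right_of_monotoneOn hp (by positivity) (by linarith)
      (hloc _ _)).trans_eq ?_
    ring
  have hf : Summable fun m : ℕ => α ^ m * G (m + 1) := by
    refine Summable.of_norm_bounded hsum2 fun m => ?_
    rw [norm_mul, Real.norm_of_nonneg (pow_nonneg hα0.le m), ← hGs]
    gcongr
    exact intervalIntegral.norm_integral_le_integral_norm
      (le_add_of_nonneg_right (by positivity))
  have hq : Summable fun m : ℕ => α ^ m * p (y + ((m : ℝ) + 1) * (x + y)) := by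
    refine Summable.of_norm_bounded hsum1 fun m => ?_
    rw [norm_mul, Real.norm_of_nonneg (pow_nonneg hα0.le m), Real.norm_eq_abs]
  have hshift (m : ℕ) : α ^ (m + 1) * G (m + 1) = α * (α ^ m * G (m + 1)) := by ring
  have hh : Summable fun m : ℕ => α ^ m * G m := by
    rw [← summable_nat_add_iff 1]
    simpa only [hshift] using hf.mul_left α
  have hhsum : ∑' m : ℕ, α ^ m * G m = α * ∑' m : ℕ, α ^ m * G (m + 1) := by
    rw [hh.tsum_eq_zero_add, hG0, mul_zero, zero_add]
    simp only [hshift, tsum_mul_left]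
  calc (1 - α) * ∑' m : ℕ, α ^ m * G (m + 1)
      = ∑' m : ℕ, (α ^ m * G (m + 1) - α ^ m * G m) := by
        rw [hf.tsum_sub hh, hhsum]
        ring
    _ ≤ ∑' m : ℕ, (x + y) * (α ^ m * p (y + ((m : ℝ) + 1) * (x + y))) := by
        refine (hf.sub hh).tsum_le_tsum (fun m => ?_) (hq.mul_left _)
        rw [← mul_sub, mul_left_comm]
        exact mul_le_mul_of_nonneg_left (hstep m) (pow_nonneg hα0.le m)
    _ = _ := tsum_mul_left
end
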